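/- Every biclosed subset R of Φ⁺ is weakly separable; that is, Span_{≥0}(R) ∩ Span_{≥0}(Φ⁺ \ R) = {0}. -/

import Mathlib

open scoped NNReal

noncomputable section

/-- The ambient vector space `V = ℝ³`. -/
abbrev V : Type := Fin 3 → ℝ

/-- The symmetric bilinear form with `⟨αᵢ,αⱼ⟩ = 1` if `i = j` and `-1` otherwise. -/
def B (x y : V) : ℝ := 2 * (∑ i, x i * y i) - (∑ i, x i) * (∑ i, y i)

/-- The associated quadratic form. -/
def Q (x : V) : ℝ := B x x

/-- The simple roots `α₁, α₂, α₃` (the standard basis vectors). -/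
def α (i : Fin 3) : V := Pi.single i 1

/-- The set of simple roots. -/
def Δ : Set V := Set.range α

/-- `f` is the reflection `r_{αᵢ} : x ↦ x - 2⟨αᵢ,x⟩αᵢ` for some `i` (note `⟨αᵢ,αᵢ⟩ = 1`). -/
def IsSimpleReflection (f : V ≃ₗ[ℝ] V) : Prop :=
  ∃ i : Fin 3, ∀ x : V, f x = x - (2 * B (α i) x) • α i

/-- The group `W ≤ GL(V)` generated by the three simple reflections:
the standard reflection representation of `U₃`. -/
def W : Subgroup (V ≃ₗ[ℝ] V) := Subgroup.closure {f | IsSimpleReflection f}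

/-- The root system `Φ = {w·αᵢ : w ∈ W, i ∈ {1,2,3}}`. -/
def Φ : Set V := {x | ∃ w ∈ W, ∃ i : Fin 3, x = w (α i)}

/-- `Span_{≥0}(X)`: the set of nonnegative linear combinations of elements of `X`. -/
def nnspan (X : Set V) : Set V := (Submodule.span ℝ≥0 X : Set V)

/-- The positive roots `Φ⁺ = Φ ∩ Span_{≥0}(Δ)`. -/
def Φpos : Set V := Φ ∩ nnspan Δ

/-- `R ⊆ Φ⁺` is closed if for all `a, b ∈ R`, `Span_{≥0}{a,b} ∩ Φ⁺ ⊆ R`. -/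
def IsClosedSet (R : Set V) : Prop := ∀ a ∈ R, ∀ b ∈ R, nnspan {a, b} ∩ Φpos ⊆ R

/-- `R` is a biclosed subset of `Φ⁺`. -/
def IsBiclosed (R : Set V) : Prop := R ⊆ Φpos ∧ IsClosedSet R ∧ IsClosedSet (Φpos \ R)

/-- The quadratic form `Q` on integer coordinates. -/
def quadInt (a b c : ℤ) : ℤ := a * a + b * b + c * c - 2 * a * b - 2 * a * c - 2 * b * c

lemma B_apply (x y : V) :
    B x y = 2 * (x 0 * y 0 + x 1 * y 1 + x 2 * y 2) - (x 0 + x 1 + x 2) * (y 0 + y 1 + y 2) := by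
  simp [B, Fin.sum_univ_three]

/-- The reflection in a simple root, as a linear automorphism. -/
def simpleReflection (i : Fin 3) : V ≃ₗ[ℝ] V :=
  LinearEquiv.ofInvolutive
    { toFun := fun x => x - (2 * B (α i) x) • α i
      map_add' := by
        intro x y
        ext j
        simp only [B_apply, Pi.add_apply, Pi.sub_apply, Pi.smul_apply, smul_eq_mul]
        ring
      map_smul' := by
        intro r x
        ext j
        simp only [B_apply, Pi.sub_apply, Pi.smul_apply, smul_eq_mul, RingHom.id_apply]
        ring }
    (by
      intro x
      ext j
      fin_cases i <;> fin_cases j <;> simp [B_apply, α] <;> ring)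

lemma simpleReflection_apply (i : Fin 3) (x : V) :
    simpleReflection i x = x - (2 * B (α i) x) • α i := rfl

lemma simpleReflection_mem (i : Fin 3) : simpleReflection i ∈ W :=
  Subgroup.subset_closure ⟨i, fun x => simpleReflection_apply i x⟩

lemma reflect_mem_Φ (i : Fin 3) {x : V} (hx : x ∈ Φ) : x - (2 * B (α i) x) • α i ∈ Φ := by
  obtain ⟨w, hw, j, rfl⟩ := hx
  exact ⟨simpleReflection i * w, W.mul_mem (simpleReflection_mem i) hw, j, rfl⟩

lemma α_mem_Φ (i : Fin 3) : α i ∈ Φ := ⟨1, W.one_mem, i, rfl⟩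

lemma vec_sub_reflect (a b c : ℝ) :
    (![a, b, c] - (2 * B (α 0) ![a, b, c]) • α 0 = ![2 * b + 2 * c - a, b, c]) ∧
    (![a, b, c] - (2 * B (α 1) ![a, b, c]) • α 1 = ![a, 2 * a + 2 * c - b, c]) ∧
    (![a, b, c] - (2 * B (α 2) ![a, b, c]) • α 2 = ![a, b, 2 * a + 2 * b - c]) := by
  refine ⟨?_, ?_, ?_⟩ <;> ext j <;> fin_cases j <;> simp [B_apply, α] <;> ring

/-- The vectors with integer coordinates and norm one. -/
def unitLattice : Set V := {x | ∃ a b c : ℤ, x = ![(a : ℝ), b, c] ∧ quadInt a b c = 1}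

lemma reflect_mem_unitLattice (i : Fin 3) {x : V} (hx : x ∈ unitLattice) :
    x - (2 * B (α i) x) • α i ∈ unitLattice := by
  obtain ⟨a, b, c, rfl, h⟩ := hx
  obtain ⟨h0, h1, h2⟩ := vec_sub_reflect a b c
  fin_cases i
  · exact ⟨2 * b + 2 * c - a, b, c, by push_cast; exact h0, by rw [← h]; unfold quadInt; ring⟩
  · exact ⟨a, 2 * a + 2 * c - b, c, by push_cast; exact h1, by rw [← h]; unfold quadInt; ring⟩
  · exact ⟨a, b, 2 * a + 2 * b - c, by push_cast; exact h2, by rw [← h]; unfold quadInt; ring⟩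

lemma α_zero : α 0 = ![1, 0, 0] := by ext j; fin_cases j <;> simp [α]
lemma α_one : α 1 = ![0, 1, 0] := by ext j; fin_cases j <;> simp [α]
lemma α_two : α 2 = ![0, 0, 1] := by ext j; fin_cases j <;> simp [α]

lemma mem_unitLattice_iff_of_mem_W {w : V ≃ₗ[ℝ] V} (hw : w ∈ W) :
    ∀ x, x ∈ unitLattice ↔ w x ∈ unitLattice := by
  induction hw using Subgroup.closure_induction with
  | mem f hf =>
    obtain ⟨i, hi⟩ := hf
    intro x
    have key : ∀ y, y ∈ unitLattice → f y ∈ unitLattice := fun y hy => by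
      rw [hi]; exact reflect_mem_unitLattice i hy
    refine ⟨key x, fun h => ?_⟩
    have h2 : f (f x) = x := by
      have : ∀ y, f y = simpleReflection i y := hi
      rw [this, this]
      exact (simpleReflection i).left_inv x
    exact h2 ▸ key _ h
  | one => intro x; rfl
  | mul f g _ _ hf hg => intro x; exact (hg x).trans (hf (g x))
  | inv f _ hf =>
    intro x
    have h := hf (f⁻¹ x)
    have e : f (f⁻¹ x) = x := f.apply_symm_apply x
    rw [e] at h
    exact h.symm

/-- Every nonnegative integer vector of norm one is built from the simple roots by reflections
that increase a coordinate. -/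
theorem quadInt_induction {M : ℤ → ℤ → ℤ → Prop} (h1 : M 1 0 0) (h2 : M 0 1 0) (h3 : M 0 0 1)
    (r1 : ∀ a b c, quadInt a b c = 1 → 0 ≤ a → 0 ≤ b → 0 ≤ c → a ≤ b + c → M a b c →
      M (2 * b + 2 * c - a) b c)
    (r2 : ∀ a b c, quadInt a b c = 1 → 0 ≤ a → 0 ≤ b → 0 ≤ c → b ≤ a + c → M a b c →
      M a (2 * a + 2 * c - b) c)
    (r3 : ∀ a b c, quadInt a b c = 1 → 0 ≤ a → 0 ≤ b → 0 ≤ c → c ≤ a + b → M a b c →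
      M a b (2 * a + 2 * b - c)) :
    ∀ a b c, 0 ≤ a → 0 ≤ b → 0 ≤ c → quadInt a b c = 1 → M a b c := by
  have mono : ∀ u : ℤ, u * u = 1 → 0 ≤ u → u = 1 := fun u hu h0 => by nlinarith
  suffices H : ∀ n : ℕ, ∀ a b c, 0 ≤ a → 0 ≤ b → 0 ≤ c → quadInt a b c = 1 →
      a + b + c ≤ n → M a b c from
    fun a b c ha hb hc h => H (a + b + c).toNat a b c ha hb hc h (by omega)
  -- a vector of norm one whose coordinates have both signs is a multiple of a simple root
  have sgn : ∀ a b c : ℤ, quadInt a b c = 1 → a < 0 → 0 ≤ b → 0 ≤ c → b = 0 ∧ c = 0 := by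
    intro a b c h ha hb hc
    unfold quadInt at h
    have hb1 : b - c = 0 := by
      by_contra hne
      have : 1 ≤ (b - c) * (b - c) := by
        rcases lt_or_gt_of_ne hne with h' | h' <;> nlinarith
      nlinarith [mul_nonneg hb (neg_nonneg.2 ha.le), mul_nonneg hc (neg_nonneg.2 ha.le)]
    have : b = c := by omega
    subst this
    have : b ≤ 0 := by
      by_contra hpos
      nlinarith [mul_pos (neg_pos.2 ha) (not_le.1 hpos)]
    omega
  intro n
  induction n with
  | zero =>
    intro a b c ha hb hc h hn
    have : a = 0 := by push_cast at hn; omega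
    have : b = 0 := by push_cast at hn; omega
    have : c = 0 := by push_cast at hn; omega
    subst_vars
    simp [quadInt] at h
  | succ n ih =>
    intro a b c ha hb hc h hn
    push_cast at hn
    have hq : a * (a - b - c) + b * (b - a - c) + c * (c - a - b) = 1 := by
      rw [← h]; unfold quadInt; ring
    have hex : b + c < a ∨ a + c < b ∨ a + b < c := by
      by_contra hcon
      push Not at hcon
      nlinarith [mul_nonneg ha (sub_nonneg.2 hcon.1), mul_nonneg hb (sub_nonneg.2 hcon.2.1),
        mul_nonneg hc (sub_nonneg.2 hcon.2.2)]
    rcases hex with h' | h' | h'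
    · have hq' : quadInt (2 * b + 2 * c - a) b c = 1 := by rw [← h]; unfold quadInt; ring
      rcases lt_or_ge (2 * b + 2 * c - a) 0 with hneg | hpos
      · obtain ⟨rfl, rfl⟩ := sgn _ _ _ hq' hneg hb hc
        obtain rfl := mono a (by simpa [quadInt] using h) ha
        exact h1
      · have := r1 _ _ _ hq' hpos hb hc (by omega) (ih _ _ _ hpos hb hc hq' (by omega))
        convert this using 1
        ring
    · have hq' : quadInt a (2 * a + 2 * c - b) c = 1 := by rw [← h]; unfold quadInt; ring
      rcases lt_or_ge (2 * a + 2 * c - b) 0 with hneg | hpos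
      · obtain ⟨rfl, rfl⟩ := sgn (2 * a + 2 * c - b) a c
          (by rw [← h]; unfold quadInt; ring) hneg ha hc
        obtain rfl := mono b (by simpa [quadInt] using h) hb
        exact h2
      · have := r2 _ _ _ hq' ha hpos hc (by omega) (ih _ _ _ ha hpos hc hq' (by omega))
        convert this using 1
        ring
    · have hq' : quadInt a b (2 * a + 2 * b - c) = 1 := by rw [← h]; unfold quadInt; ring
      rcases lt_or_ge (2 * a + 2 * b - c) 0 with hneg | hpos
      · obtain ⟨rfl, rfl⟩ := sgn (2 * a + 2 * b - c) a b
          (by rw [← h]; unfold quadInt; ring) hneg ha hb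
        obtain rfl := mono c (by simpa [quadInt] using h) hc
        exact h3
      · have := r3 _ _ _ hq' ha hb hpos (by omega) (ih _ _ _ ha hb hpos hq' (by omega))
        convert this using 1
        ring

lemma quadInt_sign {a b c : ℤ} (h : quadInt a b c = 1) :
    (0 ≤ a ∧ 0 ≤ b ∧ 0 ≤ c) ∨ (0 ≤ -a ∧ 0 ≤ -b ∧ 0 ≤ -c) := by
  have key : ∀ a b c : ℤ, quadInt a b c = 1 → 0 ≤ a * b := by
    intro a b c h
    unfold quadInt at h
    have h1 : (a + b - c) * (a + b - c) = 4 * (a * b) + 1 := by linarith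
    by_contra hn
    nlinarith [mul_self_nonneg (a + b - c)]
  have hab := key a b c h
  have hac := key a c b (by rw [← h]; unfold quadInt; ring)
  have hbc := key b c a (by rw [← h]; unfold quadInt; ring)
  have nn : ∀ {u v : ℤ}, 0 ≤ u * v → 0 < u → 0 ≤ v := fun h hu => by
    by_contra hv; nlinarith
  have np : ∀ {u v : ℤ}, 0 ≤ u * v → u < 0 → 0 ≤ -v := fun h hu => by
    by_contra hv; nlinarith
  rcases lt_trichotomy a 0 with ha | ha | ha
  · exact Or.inr ⟨by omega, np hab ha, np hac ha⟩
  · subst ha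
    rcases lt_trichotomy b 0 with hb | hb | hb
    · exact Or.inr ⟨by omega, by omega, np hbc hb⟩
    · subst hb
      rcases le_total 0 c with hc | hc
      · exact Or.inl ⟨le_rfl, le_rfl, hc⟩
      · exact Or.inr ⟨by simp, by simp, by omega⟩
    · exact Or.inl ⟨le_rfl, hb.le, nn hbc hb⟩
  · exact Or.inl ⟨ha.le, nn hab ha, nn hac ha⟩

lemma neg_mem_Φ {x : V} (hx : x ∈ Φ) : -x ∈ Φ := by
  obtain ⟨w, hw, i, rfl⟩ := hx
  refine ⟨w * simpleReflection i, W.mul_mem hw (simpleReflection_mem i), i, ?_⟩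
  have : simpleReflection i (α i) = -α i := by
    rw [simpleReflection_apply]
    ext j
    fin_cases i <;> fin_cases j <;> simp [B_apply, α] <;> norm_num
  rw [LinearEquiv.mul_apply, this, map_neg]

/-- The roots are exactly the integer vectors of norm one. -/
theorem Φ_eq_unitLattice : Φ = unitLattice := by
  ext x
  constructor
  · rintro ⟨w, hw, i, rfl⟩
    rw [← mem_unitLattice_iff_of_mem_W hw]
    fin_cases i
    · exact ⟨1, 0, 0, by simpa using α_zero, by simp [quadInt]⟩
    · exact ⟨0, 1, 0, by simpa using α_one, by simp [quadInt]⟩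
    · exact ⟨0, 0, 1, by simpa using α_two, by simp [quadInt]⟩
  · have pos := quadInt_induction (M := fun a b c => (![(a : ℝ), b, c] : V) ∈ Φ)
      (by simpa [← α_zero] using α_mem_Φ 0) (by simpa [← α_one] using α_mem_Φ 1)
      (by simpa [← α_two] using α_mem_Φ 2)
      (fun a b c _ _ _ _ _ h => by
        have := reflect_mem_Φ 0 h
        rw [(vec_sub_reflect _ _ _).1] at this
        push_cast; exact this)
      (fun a b c _ _ _ _ _ h => by
        have := reflect_mem_Φ 1 h
        rw [(vec_sub_reflect _ _ _).2.1] at this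
        push_cast; exact this)
      (fun a b c _ _ _ _ _ h => by
        have := reflect_mem_Φ 2 h
        rw [(vec_sub_reflect _ _ _).2.2] at this
        push_cast; exact this)
    rintro ⟨a, b, c, rfl, h⟩
    rcases quadInt_sign h with ⟨ha, hb, hc⟩ | ⟨ha, hb, hc⟩
    · exact pos a b c ha hb hc h
    · have := neg_mem_Φ (pos (-a) (-b) (-c) ha hb hc (by rw [← h]; unfold quadInt; ring))
      simpa using this

lemma α_mem_Δ (i : Fin 3) : α i ∈ Δ := ⟨i, rfl⟩

lemma mem_nnspan_Δ {x : V} : x ∈ nnspan Δ ↔ ∀ i, 0 ≤ x i := by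
  constructor
  · intro h
    refine Submodule.span_induction (p := fun x _ => ∀ i, 0 ≤ x i) ?_ ?_ ?_ ?_ h
    · rintro _ ⟨j, rfl⟩ i
      by_cases hij : i = j <;> simp [α, hij]
    · intro i; simp
    · intro x y _ _ hx hy i
      exact add_nonneg (hx i) (hy i)
    · intro r x _ hx i
      exact mul_nonneg r.2 (hx i)
  · intro h
    have : x = ∑ i, (⟨x i, h i⟩ : ℝ≥0) • α i := by
      ext j
      simp [α, Finset.sum_apply, Pi.single_apply]
    rw [this]
    exact Submodule.sum_mem _ fun i _ => Submodule.smul_mem _ _ (Submodule.subset_span (α_mem_Δ i))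

lemma mem_nnspan_pair {a b x : V} :
    x ∈ nnspan {a, b} ↔ ∃ s t : ℝ, 0 ≤ s ∧ 0 ≤ t ∧ x = s • a + t • b := by
  unfold nnspan
  rw [SetLike.mem_coe, Submodule.mem_span_pair]
  constructor
  · rintro ⟨s, t, rfl⟩
    exact ⟨s, t, s.2, t.2, rfl⟩
  · rintro ⟨s, t, hs, ht, rfl⟩
    exact ⟨⟨s, hs⟩, ⟨t, ht⟩, rfl⟩

lemma zero_notMem_Φ : (0 : V) ∉ Φ := by
  rw [Φ_eq_unitLattice]
  rintro ⟨a, b, c, h, hq⟩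
  have h0 := congrFun h 0
  have h1 := congrFun h 1
  have h2 := congrFun h 2
  simp only [Pi.zero_apply, Matrix.cons_val] at h0 h1 h2
  obtain rfl : a = 0 := by exact_mod_cast h0.symm
  obtain rfl : b = 0 := by exact_mod_cast h1.symm
  obtain rfl : c = 0 := by exact_mod_cast h2.symm
  simp [quadInt] at hq

lemma mem_Φpos_or_neg {x : V} (hx : x ∈ Φ) : x ∈ Φpos ∨ -x ∈ Φpos := by
  have hx' := hx
  rw [Φ_eq_unitLattice] at hx'
  obtain ⟨a, b, c, rfl, hq⟩ := hx'
  rcases quadInt_sign hq with ⟨ha, hb, hc⟩ | ⟨ha, hb, hc⟩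
  · refine Or.inl ⟨hx, mem_nnspan_Δ.2 fun i => ?_⟩
    fin_cases i <;> simpa
  · refine Or.inr ⟨neg_mem_Φ hx, mem_nnspan_Δ.2 fun i => ?_⟩
    have ha' : (0 : ℝ) ≤ -a := by exact_mod_cast ha
    have hb' : (0 : ℝ) ≤ -b := by exact_mod_cast hb
    have hc' : (0 : ℝ) ≤ -c := by exact_mod_cast hc
    fin_cases i <;> simp <;> linarith

lemma Φpos_ne_zero {x : V} (hx : x ∈ Φpos) : x ≠ 0 := fun h => zero_notMem_Φ (h ▸ hx.1)

lemma neg_notMem_Φpos {x : V} (hx : x ∈ Φpos) : -x ∉ Φpos := by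
  intro h
  apply Φpos_ne_zero hx
  ext i
  have h1 := mem_nnspan_Δ.1 hx.2 i
  have h2 := mem_nnspan_Δ.1 h.2 i
  simp only [Pi.neg_apply] at h2
  simp only [Pi.zero_apply]
  linarith

/-- A choice of one root from each pair `±x` that is closed in every plane. -/
structure IsSignSystem (P : Set V) : Prop where
  subset : P ⊆ Φ
  closed : ∀ a ∈ P, ∀ b ∈ P, ∀ x ∈ Φ, ∀ s t : ℝ, 0 ≤ s → 0 ≤ t → x = s • a + t • b → x ∈ P
  neg : ∀ x ∈ Φ, (-x ∈ P ↔ x ∉ P)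

/-- The sign system attached to a set of positive roots. -/
def signSystem (R : Set V) : Set V := {x | x ∈ R ∨ -x ∈ Φpos \ R}

lemma IsClosedSet.mem {R : Set V} (h : IsClosedSet R) {a b x : V} (ha : a ∈ R) (hb : b ∈ R)
    (hx : x ∈ Φpos) {s t : ℝ} (hs : 0 ≤ s) (ht : 0 ≤ t) (e : x = s • a + t • b) : x ∈ R :=
  h a ha b hb ⟨mem_nnspan_pair.2 ⟨s, t, hs, ht, e⟩, hx⟩

lemma Φpos_nonneg {x : V} (hx : x ∈ Φpos) (i : Fin 3) : 0 ≤ x i := mem_nnspan_Δ.1 hx.2 i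

lemma mem_Φpos_of_comb {a b x : V} (ha : a ∈ Φpos) (hb : b ∈ Φpos) (hx : x ∈ Φ) {s t : ℝ}
    (hs : 0 ≤ s) (ht : 0 ≤ t) (e : x = s • a + t • b) : x ∈ Φpos := by
  refine ⟨hx, mem_nnspan_Δ.2 fun i => ?_⟩
  rw [e]
  exact add_nonneg (mul_nonneg hs (Φpos_nonneg ha i)) (mul_nonneg ht (Φpos_nonneg hb i))

lemma IsBiclosed.mem_of_sub {R : Set V} (hR : IsBiclosed R) {a b x : V} (ha : a ∈ R)
    (hb : b ∈ Φpos \ R) (hx : x ∈ Φ) {s t : ℝ} (hs : 0 ≤ s) (ht : 0 ≤ t)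
    (e : x = s • a - t • b) : x ∈ signSystem R := by
  obtain ⟨hsub, hc, hc'⟩ := hR
  rcases mem_Φpos_or_neg hx with hp | hn
  · by_contra hcon
    have hxR : x ∉ R := fun h => hcon (Or.inl h)
    rcases hs.eq_or_lt with rfl | hs
    · apply neg_notMem_Φpos hp
      refine mem_Φpos_of_comb hb.1 hb.1 (neg_mem_Φ hx) ht le_rfl ?_
      rw [e]; simp
    · refine (hc'.mem ⟨hp, hxR⟩ hb (hsub ha) (inv_nonneg.2 hs.le)
        (mul_nonneg (inv_nonneg.2 hs.le) ht) ?_).2 ha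
      rw [e, mul_smul, ← smul_add, sub_add_cancel, smul_smul, inv_mul_cancel₀ hs.ne', one_smul]
  · refine Or.inr ⟨hn, fun hxR => ?_⟩
    rcases ht.eq_or_lt with rfl | ht
    · apply neg_notMem_Φpos hn
      rw [neg_neg]
      refine mem_Φpos_of_comb (hsub ha) (hsub ha) hx hs le_rfl ?_
      rw [e]; simp
    · refine hb.2 (hc.mem hxR ha hb.1 (inv_nonneg.2 ht.le)
        (mul_nonneg (inv_nonneg.2 ht.le) hs) ?_)
      rw [e, mul_smul, ← smul_add, neg_sub, sub_add_cancel, smul_smul, inv_mul_cancel₀ ht.ne',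
        one_smul]

lemma IsBiclosed.isSignSystem {R : Set V} (hR : IsBiclosed R) : IsSignSystem (signSystem R) where
  subset := by
    rintro x (hx | hx)
    · exact (hR.1 hx).1
    · simpa using neg_mem_Φ hx.1.1
  closed := by
    rintro a (ha | ha) b (hb | hb) x hx s t hs ht e
    · exact Or.inl (hR.2.1.mem ha hb
        (mem_Φpos_of_comb (hR.1 ha) (hR.1 hb) hx hs ht e) hs ht e)
    · exact hR.mem_of_sub ha hb hx hs ht (by rw [e]; simp)
    · exact hR.mem_of_sub hb ha hx ht hs (by rw [e]; simp [add_comm])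
    · have e' : -x = s • -a + t • -b := by rw [e]; simp [add_comm]
      exact Or.inr (hR.2.2.mem ha hb
        (mem_Φpos_of_comb ha.1 hb.1 (neg_mem_Φ hx) hs ht e') hs ht e')
  neg := by
    intro x hx
    unfold signSystem
    simp only [Set.mem_ofPred_eq, neg_neg, Set.mem_sdiff]
    rcases mem_Φpos_or_neg hx with hp | hp
    · have hn := neg_notMem_Φpos hp
      have hn' : -x ∉ R := fun h => hn (hR.1 h)
      tauto
    · have hn := neg_notMem_Φpos hp
      rw [neg_neg] at hn
      have hn' : x ∉ R := fun h => hn (hR.1 h)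
      tauto

/-- The determinant of two integer vectors. -/
def det (p q : ℤ × ℤ) : ℤ := p.1 * q.2 - p.2 * q.1

/-- The symmetric product of two integer vectors, as a vector of `V`; its norm is the square of
their determinant. -/
def prodV (p q : ℤ × ℤ) : V :=
  ![((p.2 * q.2 : ℤ) : ℝ), ((p.1 * q.1 : ℤ) : ℝ), (((p.1 - p.2) * (q.1 - q.2) : ℤ) : ℝ)]

lemma prodV_mem_Φ {p q : ℤ × ℤ} (h : det p q ^ 2 = 1) : prodV p q ∈ Φ := by
  rw [Φ_eq_unitLattice]
  refine ⟨_, _, _, rfl, ?_⟩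
  rw [← h]
  unfold quadInt det
  ring

lemma prodV_comm (p q : ℤ × ℤ) : prodV p q = prodV q p := by
  unfold prodV
  ext i
  fin_cases i <;> (simp; ring)

lemma prodV_neg_left (p q : ℤ × ℤ) : prodV (-p) q = -prodV p q := by
  unfold prodV
  ext i
  fin_cases i <;> simp
  ring

lemma exists_prodV_of_mem_Φ {x : V} (hx : x ∈ Φ) : ∃ p q, det p q = 1 ∧ x = prodV p q := by
  have key := quadInt_induction (M := fun a b c => ∃ p q : ℤ × ℤ, det p q = 1 ∧
      a = p.2 * q.2 ∧ b = p.1 * q.1 ∧ c = (p.1 - p.2) * (q.1 - q.2))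
    ⟨(1, 1), (0, 1), by simp [det]⟩ ⟨(1, 0), (1, 1), by simp [det]⟩
    ⟨(0, 1), (-1, 0), by simp [det]⟩
    (by
      rintro _ _ _ _ _ _ _ _ ⟨p, q, h, rfl, rfl, rfl⟩
      refine ⟨(q.1, 2 * q.1 - q.2), (p.1, 2 * p.1 - p.2), ?_, ?_, ?_, ?_⟩ <;>
        simp only [det] at h ⊢ <;> linarith)
    (by
      rintro _ _ _ _ _ _ _ _ ⟨p, q, h, rfl, rfl, rfl⟩
      refine ⟨(2 * q.2 - q.1, q.2), (2 * p.2 - p.1, p.2), ?_, ?_, ?_, ?_⟩ <;>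
        simp only [det] at h ⊢ <;> linarith)
    (by
      rintro _ _ _ _ _ _ _ _ ⟨p, q, h, rfl, rfl, rfl⟩
      refine ⟨(q.1, -q.2), (p.1, -p.2), ?_, ?_, ?_, ?_⟩ <;>
        simp only [det] at h ⊢ <;> linarith)
  rw [Φ_eq_unitLattice] at hx
  obtain ⟨a, b, c, rfl, h⟩ := hx
  rcases quadInt_sign h with ⟨ha, hb, hc⟩ | ⟨ha, hb, hc⟩
  · obtain ⟨p, q, hd, rfl, rfl, rfl⟩ := key a b c ha hb hc h
    exact ⟨p, q, hd, rfl⟩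
  · obtain ⟨p, q, hd, h0, h1, h2⟩ := key (-a) (-b) (-c) ha hb hc
      (by rw [← h]; unfold quadInt; ring)
    refine ⟨-q, p, ?_, ?_⟩
    · simp only [det, Prod.fst_neg, Prod.snd_neg] at hd ⊢; linarith
    · rw [prodV_neg_left, prodV_comm]
      unfold prodV
      rw [← h0, ← h1, ← h2]
      ext i
      fin_cases i <;> simp

/-- The properties of a sign system in terms of bases of `ℤ²`: `S p q` says that the root
`prodV p q` is chosen. -/
structure IsSign (S : ℤ × ℤ → ℤ × ℤ → Prop) : Prop where
  symm : ∀ p q, S p q → S q p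
  neg : ∀ p q, det p q ^ 2 = 1 → (S (-p) q ↔ ¬S p q)
  fan : ∀ w v (i j k : ℤ), det w v ^ 2 = 1 → i < j → j < k → S w (v + i • w) → S w (v + k • w) →
    S w (v + j • w)
  refl : ∀ p q (a b c d : ℤ), det p q = 1 → S p q → (a * d - b * c) ^ 2 = 1 →
    a * d + b * c ≤ 0 → S (a • p + b • q) (c • p + d • q) → S (-a • p + b • q) (-c • p + d • q)

lemma det_comb (p q : ℤ × ℤ) (a b c d : ℤ) :
    det (a • p + b • q) (c • p + d • q) = (a * d - b * c) * det p q := by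
  simp only [det, Prod.fst_add, Prod.snd_add, Prod.smul_fst, Prod.smul_snd, smul_eq_mul]
  ring

lemma IsSignSystem.isSign {P : Set V} (hP : IsSignSystem P) :
    IsSign (fun p q => prodV p q ∈ P) where
  symm p q h := by rwa [prodV_comm]
  neg p q h := by rw [prodV_neg_left, hP.neg _ (prodV_mem_Φ h)]
  fan w v i j k hd hij hjk hi hk := by
    have hik : (0 : ℝ) < (k : ℝ) - i := by exact_mod_cast sub_pos.2 (hij.trans hjk)
    have h1 : (0 : ℝ) < (j : ℝ) - i := by exact_mod_cast sub_pos.2 hij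
    have h2 : (0 : ℝ) < (k : ℝ) - j := by exact_mod_cast sub_pos.2 hjk
    refine hP.closed _ hi _ hk _ (prodV_mem_Φ ?_) (((k : ℝ) - j) / (k - i))
      (((j : ℝ) - i) / (k - i)) (div_pos h2 hik).le (div_pos h1 hik).le ?_
    · rw [← hd]
      simp only [det, Prod.fst_add, Prod.snd_add, Prod.smul_fst, Prod.smul_snd, smul_eq_mul]
      ring
    · have e : ((k : ℝ) - i) • prodV w (v + j • w) = ((k : ℝ) - j) • prodV w (v + i • w) +
          ((j : ℝ) - i) • prodV w (v + k • w) := by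
        unfold prodV
        ext n
        fin_cases n <;> simp <;> ring
      rw [div_eq_inv_mul, div_eq_inv_mul, mul_smul, mul_smul, ← smul_add, ← e, smul_smul,
        inv_mul_cancel₀ hik.ne', one_smul]
  refl p q a b c d hd hpq h1 h2 h := by
    refine hP.closed _ h _ hpq _ (prodV_mem_Φ ?_) 1 (-2 * (a * d + b * c : ℤ)) zero_le_one ?_ ?_
    · rw [det_comb, hd]; linear_combination h1
    · have : ((a * d + b * c : ℤ) : ℝ) ≤ 0 := by exact_mod_cast h2
      linarith
    · unfold prodV
      ext n
      fin_cases n <;> simp <;> ring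

/-- The vector representing the quadratic form with coefficients `a, b, c`. -/
def formVec (a b c : ℝ) : V := ![c + b, a + b, -b]

lemma formVec_pairing (a b c : ℝ) (p q : ℤ × ℤ) :
    formVec a b c 0 * prodV p q 0 + formVec a b c 1 * prodV p q 1 +
      formVec a b c 2 * prodV p q 2 = a * (p.1 * q.1) + b * (p.1 * q.2 + p.2 * q.1) +
      c * (p.2 * q.2) := by
  simp [formVec, prodV]
  ring

lemma formVec_ne_zero {a b c : ℝ} (h : ¬(a = 0 ∧ b = 0 ∧ c = 0)) : formVec a b c ≠ 0 := by
  intro e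
  apply h
  have h0 := congrFun e 0
  have h1 := congrFun e 1
  have h2 := congrFun e 2
  simp [formVec] at h0 h1 h2
  subst h2
  simpa [and_comm] using And.intro h0 h1

lemma exists_functional_of_triangle {P : Set V} (hP : IsSignSystem P) {p q : ℤ × ℤ}
    (hd : det p q = 1) (h1 : prodV p (p + q) ∈ P) (h2 : prodV (p + q) q ∈ P)
    (h3 : prodV q (-p) ∈ P) :
    ∃ l : V, l ≠ 0 ∧ ∀ x ∈ P, 0 ≤ l 0 * x 0 + l 1 * x 1 + l 2 * x 2 := by
  set T : ℤ → ℤ → ℤ → V := fun a b c => (a : ℝ) • prodV p (p + q) + (b : ℝ) • prodV (p + q) q +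
    (c : ℝ) • prodV q (-p) with hT
  have hΦ : ∀ a b c, quadInt a b c = 1 → T a b c ∈ Φ := by
    intro a b c h
    rw [Φ_eq_unitLattice]
    refine ⟨a * (p.2 * (p.2 + q.2)) + b * ((p.2 + q.2) * q.2) - c * (q.2 * p.2),
      a * (p.1 * (p.1 + q.1)) + b * ((p.1 + q.1) * q.1) - c * (q.1 * p.1),
      a * ((p.1 - p.2) * (p.1 + q.1 - (p.2 + q.2))) +
        b * ((p.1 + q.1 - (p.2 + q.2)) * (q.1 - q.2)) - c * ((q.1 - q.2) * (p.1 - p.2)), ?_, ?_⟩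
    · ext n
      simp only [hT, prodV]
      fin_cases n <;> simp <;> ring
    · have : (1 : ℤ) = det p q ^ 2 * quadInt a b c := by rw [hd, h]; ring
      rw [this]
      unfold quadInt det
      ring
  have key := quadInt_induction (M := fun a b c => T a b c ∈ P)
    (by simpa [hT] using h1) (by simpa [hT] using h2) (by simpa [hT] using h3)
    (fun a b c hq _ _ _ hle h => by
      have hle' : (a : ℝ) ≤ b + c := by exact_mod_cast hle
      refine hP.closed _ h _ h1 _ (hΦ _ _ _ (by rw [← hq]; unfold quadInt; ring)) 1
        (2 * (b + c - a)) zero_le_one (by linarith) ?_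
      simp only [hT]
      push_cast
      module)
    (fun a b c hq _ _ _ hle h => by
      have hle' : (b : ℝ) ≤ a + c := by exact_mod_cast hle
      refine hP.closed _ h _ h2 _ (hΦ _ _ _ (by rw [← hq]; unfold quadInt; ring)) 1
        (2 * (a + c - b)) zero_le_one (by linarith) ?_
      simp only [hT]
      push_cast
      module)
    (fun a b c hq _ _ _ hle h => by
      have hle' : (c : ℝ) ≤ a + b := by exact_mod_cast hle
      refine hP.closed _ h _ h3 _ (hΦ _ _ _ (by rw [← hq]; unfold quadInt; ring)) 1
        (2 * (a + b - c)) zero_le_one (by linarith) ?_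
      simp only [hT]
      push_cast
      module)
  refine ⟨formVec ((p.2 ^ 2 + q.2 ^ 2 + (p.2 + q.2) ^ 2 : ℤ))
    (-(p.1 * p.2 + q.1 * q.2 + (p.1 + q.1) * (p.2 + q.2)) : ℤ)
    ((p.1 ^ 2 + q.1 ^ 2 + (p.1 + q.1) ^ 2 : ℤ)), formVec_ne_zero ?_, ?_⟩
  · rintro ⟨ha, -, hc⟩
    have ha' : p.2 ^ 2 + q.2 ^ 2 + (p.2 + q.2) ^ 2 = 0 := by exact_mod_cast ha
    have hc' : p.1 ^ 2 + q.1 ^ 2 + (p.1 + q.1) ^ 2 = 0 := by exact_mod_cast hc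
    have e1 : p.2 = 0 := by nlinarith
    have e2 : p.1 = 0 := by nlinarith
    simp [det, e1, e2] at hd
  · intro x hx
    obtain ⟨u, v, huv, rfl⟩ := exists_prodV_of_mem_Φ (hP.subset hx)
    set t1 := det u q * det v q with ht1
    set t2 := det p u * det p v with ht2
    set t3 := (det u q - det p u) * (det v q - det p v) with ht3
    have hdR : ((p.1 : ℝ) * q.2 - p.2 * q.1) = 1 := by exact_mod_cast hd
    have hq : quadInt t1 t2 t3 = 1 := by
      have : (1 : ℤ) = det p q ^ 2 * det u v ^ 2 := by rw [hd, huv]; ring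
      rw [this, ht1, ht2, ht3]
      unfold quadInt det
      ring
    have hx' : T t1 t2 t3 = prodV u v := by
      have : prodV u v = ((det p q : ℝ) ^ 2) • prodV u v := by rw [hd]; simp
      rw [this]
      simp only [hT, ht1, ht2, ht3, det, prodV]
      ext n
      fin_cases n <;> simp <;> ring
    have hsum : formVec ((p.2 ^ 2 + q.2 ^ 2 + (p.2 + q.2) ^ 2 : ℤ))
        (-(p.1 * p.2 + q.1 * q.2 + (p.1 + q.1) * (p.2 + q.2)) : ℤ)
        ((p.1 ^ 2 + q.1 ^ 2 + (p.1 + q.1) ^ 2 : ℤ)) 0 * prodV u v 0 + formVec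
        ((p.2 ^ 2 + q.2 ^ 2 + (p.2 + q.2) ^ 2 : ℤ))
        (-(p.1 * p.2 + q.1 * q.2 + (p.1 + q.1) * (p.2 + q.2)) : ℤ)
        ((p.1 ^ 2 + q.1 ^ 2 + (p.1 + q.1) ^ 2 : ℤ)) 1 * prodV u v 1 + formVec
        ((p.2 ^ 2 + q.2 ^ 2 + (p.2 + q.2) ^ 2 : ℤ))
        (-(p.1 * p.2 + q.1 * q.2 + (p.1 + q.1) * (p.2 + q.2)) : ℤ)
        ((p.1 ^ 2 + q.1 ^ 2 + (p.1 + q.1) ^ 2 : ℤ)) 2 * prodV u v 2 =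
        ((t1 + t2 + t3 : ℤ) : ℝ) := by
      rw [formVec_pairing, ht1, ht2, ht3]
      unfold det
      push_cast
      ring
    rw [hsum]
    rcases quadInt_sign hq with ⟨ha, hb, hc⟩ | ⟨ha, hb, hc⟩
    · exact_mod_cast add_nonneg (add_nonneg ha hb) hc
    · exfalso
      have hneg := key (-t1) (-t2) (-t3) ha hb hc (by rw [← hq]; unfold quadInt; ring)
      have e : T (-t1) (-t2) (-t3) = -prodV u v := by
        rw [← hx']; simp only [hT]; push_cast; module
      rw [e] at hneg
      exact (hP.neg _ (hP.subset hx)).1 hneg hx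

lemma det_self (p : ℤ × ℤ) : det p p = 0 := by unfold det; ring

lemma det_swap (p q : ℤ × ℤ) : det q p = -det p q := by unfold det; ring

lemma det_add_left (p q r : ℤ × ℤ) : det (p + q) r = det p r + det q r := by
  simp only [det, Prod.fst_add, Prod.snd_add]; ring

lemma det_add_right (p q r : ℤ × ℤ) : det r (p + q) = det r p + det r q := by
  simp only [det, Prod.fst_add, Prod.snd_add]; ring

lemma det_neg_left (p q : ℤ × ℤ) : det (-p) q = -det p q := by
  simp only [det, Prod.fst_neg, Prod.snd_neg]; ring

lemma det_neg_right (p q : ℤ × ℤ) : det p (-q) = -det p q := by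
  simp only [det, Prod.fst_neg, Prod.snd_neg]; ring

lemma det_smul_left (n : ℤ) (p q : ℤ × ℤ) : det (n • p) q = n * det p q := by
  simp only [det, Prod.smul_fst, Prod.smul_snd, smul_eq_mul]; ring

lemma det_smul_right (n : ℤ) (p q : ℤ × ℤ) : det p (n • q) = n * det p q := by
  simp only [det, Prod.smul_fst, Prod.smul_snd, smul_eq_mul]; ring

lemma eq_comb_of_det {p q : ℤ × ℤ} (h : det p q = 1) (u : ℤ × ℤ) :
    u = det u q • p + det p u • q := by
  ext <;>
    simp only [det, Prod.fst_add, Prod.snd_add, Prod.smul_fst, Prod.smul_snd, smul_eq_mul] at h ⊢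
  · linear_combination (-u.1) * h
  · linear_combination (-u.2) * h

namespace IsSign

variable {S : ℤ × ℤ → ℤ × ℤ → Prop}

lemma comm (hS : IsSign S) (p q : ℤ × ℤ) : S p q ↔ S q p := ⟨hS.symm p q, hS.symm q p⟩

lemma neg_right (hS : IsSign S) {p q : ℤ × ℤ} (h : det p q ^ 2 = 1) : S p (-q) ↔ ¬S p q := by
  rw [hS.comm, hS.neg q p (by rw [det_swap, neg_sq, h]), hS.comm]

lemma neg_neg (hS : IsSign S) {p q : ℤ × ℤ} (h : det p q ^ 2 = 1) : S (-p) (-q) ↔ S p q := by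
  rw [hS.neg_right (by rw [det_neg_left, neg_sq, h]), hS.neg _ _ h, not_not]

lemma det_add_smul (w v : ℤ × ℤ) (k : ℤ) : det w (v + k • w) = det w v := by
  rw [det_add_right, det_smul_right, det_self]; ring

lemma compl (hS : IsSign S) : IsSign (fun p q => ¬S p q) where
  symm p q h := fun h' => h (hS.symm _ _ h')
  neg p q h := by rw [hS.neg p q h]
  fan w v i j k hd hij hjk hi hk := by
    have hd' : ∀ n : ℤ, det w (v + n • w) ^ 2 = 1 := fun n => by rw [det_add_smul, hd]
    have e : ∀ n : ℤ, v + n • w = v + (-n) • (-w) := fun n => by rw [smul_neg, neg_smul, _root_.neg_neg]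
    rw [← hS.neg _ _ (hd' _), e] at hi hk ⊢
    exact hS.fan (-w) v (-k) (-j) (-i) (by rw [det_neg_left, neg_sq, hd]) (by omega) (by omega)
      hk hi
  refl p q a b c d hd hpq h1 h2 h := by
    have hw : det (a • p + b • q) (c • p + d • q) ^ 2 = 1 := by
      rw [det_comb, hd]; linear_combination h1
    have hw' : det (-a • p + b • q) (-c • p + d • q) ^ 2 = 1 := by
      rw [det_comb, hd]; linear_combination h1
    have e1 : -(a • p + b • q) = -b • q + a • -p := by module
    have e2 : c • p + d • q = d • q + (-c) • -p := by module
    have e3 : - -b • q + a • -p = -a • p + b • q := by module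
    have e4 : -d • q + (-c) • -p = -(-c • p + d • q) := by module
    rw [← hS.neg _ _ hw, e1, e2] at h
    have := hS.refl q (-p) (-b) a d (-c) (by rw [det_neg_right, det_swap, hd]; ring)
      ((hS.neg_right (by rw [det_swap, hd]; norm_num)).2 fun h' => hpq (hS.symm _ _ h'))
      (by linear_combination h1) (by linarith) h
    rw [e3, e4] at this
    exact (hS.neg_right hw').1 this

end IsSign

/-- The roots `prodV w v` with `w` fixed are eventually chosen in the positive direction, and
eventually not chosen in the negative direction. -/
def Up (S : ℤ × ℤ → ℤ × ℤ → Prop) (w : ℤ × ℤ) : Prop :=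
  ∀ v, det w v = 1 → ∃ K₀ : ℤ, ∀ K ≥ K₀, S w (v + K • w) ∧ ¬S w (v - K • w)

namespace IsSign

variable {S : ℤ × ℤ → ℤ × ℤ → Prop}

lemma up_of_lt (hS : IsSign S) {w v : ℤ × ℤ} {k' k : ℤ} (hd : det w v = 1) (hk : k' < k)
    (h' : ¬S w (v + k' • w)) (h : S w (v + k • w)) : Up S w := by
  have hd2 : det w v ^ 2 = 1 := by rw [hd]; norm_num
  have up : ∀ n, k ≤ n → S w (v + n • w) := by
    intro n hn
    rcases hn.eq_or_lt with rfl | hn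
    · exact h
    · by_contra hc
      exact hS.compl.fan w v k' k n hd2 hk hn h' hc h
  have down : ∀ n, n ≤ k' → ¬S w (v + n • w) := by
    intro n hn hc
    rcases hn.eq_or_lt with rfl | hn
    · exact h' hc
    · exact h' (hS.fan w v n k' k hd2 hn hk hc h)
  intro v' hv'
  have e := eq_comb_of_det hd v'
  have ev : v' = v + (det v' v) • w := by
    rw [hv', one_smul, add_comm] at e
    exact e
  set m := det v' v
  refine ⟨|k| + |k'| + |m|, fun K hK => ⟨?_, ?_⟩⟩
  · have : v' + K • w = v + (m + K) • w := by rw [ev]; module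
    rw [this]
    apply up
    have := neg_abs_le m; have := le_abs_self k; have := abs_nonneg k'
    omega
  · have : v' - K • w = v + (m - K) • w := by rw [ev]; module
    rw [this]
    apply down
    have := le_abs_self m; have := neg_abs_le k'; have := abs_nonneg k
    omega

lemma up_neg (hS : IsSign S) {w : ℤ × ℤ} (h : Up S w) : Up S (-w) := by
  intro v hv
  have hv' : det w (-v) = 1 := by rw [det_neg_right, ← det_neg_left, hv]
  obtain ⟨K₀, hK⟩ := h (-v) hv'
  refine ⟨K₀, fun K hKK => ?_⟩
  have e1 : v + K • -w = -(-v + K • w) := by module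
  have e2 : v - K • -w = -(-v - K • w) := by module
  have d1 : det w (-v + K • w) ^ 2 = 1 := by rw [det_add_smul, hv']; norm_num
  have d2 : det w (-v - K • w) ^ 2 = 1 := by
    rw [sub_eq_add_neg, ← neg_smul, det_add_smul, hv']; norm_num
  rw [e1, e2, hS.neg_neg d1, hS.neg_neg d2]
  exact hK K hKK

/-- A chosen root `prodV p q` forbids an opposite behaviour at two vectors exchanged by its
reflection. -/
lemma up_reflect (hS : IsSign S) {p q : ℤ × ℤ} (hd : det p q = 1) (h : S p q) {i j : ℤ}
    (hi : 0 < i) (hj : 0 < j) (hij : IsCoprime i j) (hu : Up S (-i • p + j • q))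
    (hu' : Up (fun a b => ¬S a b) (i • p + j • q)) : False := by
  obtain ⟨c, d, hcd⟩ := hij
  obtain ⟨K₁, h1⟩ := hu (-d • p + -c • q) (by rw [det_comb, hd]; linear_combination hcd)
  obtain ⟨K₂, h2⟩ := hu' (-d • p + c • q) (by rw [det_comb, hd]; linear_combination hcd)
  set K := max (max K₁ K₂) (|i * c| + |j * d|) with hK
  have hK1 : K₁ ≤ K := (le_max_left _ _).trans (le_max_left _ _)
  have hK2 : K₂ ≤ K := (le_max_right _ _).trans (le_max_left _ _)
  have hK3 : |i * c| + |j * d| ≤ K := le_max_right _ _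
  have a1 := (h1 K hK1).1
  have a2 := (h2 K hK2).2
  rw [not_not] at a2
  have e1 : -d • p + -c • q + K • (-i • p + j • q) = (-d - K * i) • p + (-c + K * j) • q := by
    module
  rw [e1] at a1
  have hK0 : 0 ≤ K := le_trans (by positivity) hK3
  have hKij : K ≤ K * (i * j) := le_mul_of_one_le_right hK0 (by nlinarith)
  have a3 := hS.refl p q _ _ _ _ hd h
    (by
      have : -i * (-c + K * j) - j * (-d - K * i) = 1 := by linear_combination hcd
      rw [this]; norm_num)
    (by
      have := le_abs_self (i * c)
      have := neg_abs_le (j * d)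
      nlinarith) a1
  have e2 : (- -i) • p + j • q = i • p + j • q := by module
  have e3 : -(-d - K * i) • p + (-c + K * j) • q = -(-d • p + c • q - K • (i • p + j • q)) := by
    module
  rw [e2, e3] at a3
  refine (hS.neg_right ?_).1 a3 a2
  rw [sub_eq_add_neg, ← neg_smul, det_add_smul, det_comb, hd]
  have : i * c - j * (-d) = 1 := by linear_combination hcd
  rw [this]; norm_num

end IsSign

/-- Two consecutive entries of a list. -/
def Adj (l : List (ℤ × ℤ)) (p q : ℤ × ℤ) : Prop := ∃ X Y, l = X ++ p :: q :: Y

lemma Adj.map_neg {l : List (ℤ × ℤ)} {p q : ℤ × ℤ} (h : Adj l p q) :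
    Adj (l.map Neg.neg) (-p) (-q) := by
  obtain ⟨X, Y, rfl⟩ := h
  exact ⟨X.map Neg.neg, Y.map Neg.neg, by simp⟩

lemma Adj.mem_left {l : List (ℤ × ℤ)} {p q : ℤ × ℤ} (h : Adj l p q) : p ∈ l := by
  obtain ⟨X, Y, rfl⟩ := h; simp

lemma Adj.mem_right {l : List (ℤ × ℤ)} {p q : ℤ × ℤ} (h : Adj l p q) : q ∈ l := by
  obtain ⟨X, Y, rfl⟩ := h; simp

lemma Adj.rel {l : List (ℤ × ℤ)} {p q : ℤ × ℤ} {r : ℤ × ℤ → ℤ × ℤ → Prop} (h : Adj l p q)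
    (hl : l.IsChain r) : r p q := by
  obtain ⟨X, Y, rfl⟩ := h
  exact (List.isChain_append_cons_cons.1 hl).2.1

lemma exists_adj_sign_change {f : ℤ × ℤ → ℤ} (l : List (ℤ × ℤ)) (s t : ℤ × ℤ) (hs : 0 ≤ f s)
    (ht : f t ≤ 0) : ∃ p q, Adj (s :: (l ++ [t])) p q ∧ 0 ≤ f p ∧ f q ≤ 0 := by
  induction l generalizing s with
  | nil => exact ⟨s, t, ⟨[], [], rfl⟩, hs, ht⟩
  | cons a l ih =>
    rcases le_total 0 (f a) with ha | ha
    · obtain ⟨p, q, ⟨X, Y, e⟩, h1, h2⟩ := ih a ha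
      exact ⟨p, q, ⟨s :: X, Y, by rw [List.cons_append, e, List.cons_append]⟩, h1, h2⟩
    · exact ⟨s, a, ⟨[], l ++ [t], rfl⟩, hs, ha⟩

/-- A subdivision of the circle of directions: a chain from `x` through `L`
to `y`, followed by a chain from `y` through `M` to `-x`. -/
structure Config where
  /-- the first vector of the first chain -/
  x : ℤ × ℤ
  /-- the last vector of the first chain -/
  y : ℤ × ℤ
  /-- the interior of the first chain -/
  L : List (ℤ × ℤ)
  /-- the interior of the second chain -/
  M : List (ℤ × ℤ)

namespace Config

/-- The first chain. -/
def A (c : Config) : List (ℤ × ℤ) := c.x :: (c.L ++ [c.y])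

/-- The second chain. -/
def B (c : Config) : List (ℤ × ℤ) := c.y :: (c.M ++ [-c.x])

/-- The subdivision with the two chains exchanged. -/
def rot (c : Config) : Config := ⟨c.y, -c.x, c.M, c.L.map Neg.neg⟩

lemma A_rot (c : Config) : c.rot.A = c.B := rfl

lemma B_rot (c : Config) : c.rot.B = c.A.map Neg.neg := by simp [rot, A, B]

/-- `p` and `q` are, up to a common sign, consecutive in one of the chains. -/
def Node (c : Config) (p q : ℤ × ℤ) : Prop :=
  Adj c.A p q ∨ Adj c.A (-p) (-q) ∨ Adj c.B p q ∨ Adj c.B (-p) (-q)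

/-- `u` is, up to sign, in one of the chains. -/
def Vtx (c : Config) (u : ℤ × ℤ) : Prop := u ∈ c.A ∨ -u ∈ c.A ∨ u ∈ c.B ∨ -u ∈ c.B

variable {c : Config}

lemma Node.neg {p q : ℤ × ℤ} (h : c.Node p q) : c.Node (-p) (-q) := by
  unfold Node at *
  rw [neg_neg, neg_neg]
  tauto

lemma Vtx.neg {u : ℤ × ℤ} (h : c.Vtx u) : c.Vtx (-u) := by
  unfold Vtx at *
  rw [neg_neg]
  tauto

lemma Node.vtx_left {p q : ℤ × ℤ} (h : c.Node p q) : c.Vtx p := by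
  rcases h with h | h | h | h
  · exact Or.inl h.mem_left
  · exact Or.inr (Or.inl h.mem_left)
  · exact Or.inr (Or.inr (Or.inl h.mem_left))
  · exact Or.inr (Or.inr (Or.inr h.mem_left))

lemma Node.vtx_right {p q : ℤ × ℤ} (h : c.Node p q) : c.Vtx q := by
  rcases h with h | h | h | h
  · exact Or.inl h.mem_right
  · exact Or.inr (Or.inl h.mem_right)
  · exact Or.inr (Or.inr (Or.inl h.mem_right))
  · exact Or.inr (Or.inr (Or.inr h.mem_right))

lemma Node.rot {p q : ℤ × ℤ} (h : c.Node p q) : c.rot.Node p q := by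
  unfold Node
  rw [A_rot, B_rot]
  rcases h with h | h | h | h
  · exact Or.inr (Or.inr (Or.inr h.map_neg))
  · have := h.map_neg
    rw [neg_neg, neg_neg] at this
    exact Or.inr (Or.inr (Or.inl this))
  · exact Or.inl h
  · exact Or.inr (Or.inl h)

lemma vtx_rot {u : ℤ × ℤ} : c.rot.Vtx u ↔ c.Vtx u := by
  unfold Vtx
  rw [A_rot, B_rot]
  simp only [List.mem_map, neg_eq_iff_eq_neg, exists_eq_right, neg_neg]
  tauto

lemma vtx_mono {c' : Config} (hA : ∀ u ∈ c.A, c'.Vtx u) (hB : ∀ u ∈ c.B, c'.Vtx u) :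
    ∀ u, c.Vtx u → c'.Vtx u := by
  rintro u (h | h | h | h)
  · exact hA u h
  · simpa using (hA _ h).neg
  · exact hB u h
  · simpa using (hB _ h).neg

end Config

/-- The first chain of the subdivision consists of chosen roots and the second of the others. -/
structure IsState (S : ℤ × ℤ → ℤ × ℤ → Prop) (c : Config) : Prop where
  chainA : c.A.IsChain (fun p q => det p q = 1 ∧ S p q)
  chainB : c.B.IsChain (fun p q => det p q = 1 ∧ ¬S p q)
  ord : (c.A ++ c.M).Pairwise (fun p q => 0 < det p q)

/-- No basic triangle has all its sides chosen or all of them not chosen. -/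
def Nonpure (S : ℤ × ℤ → ℤ × ℤ → Prop) : Prop :=
  ∀ p q, det p q = 1 → ¬(S p (p + q) ∧ S (p + q) q ∧ S q (-p)) ∧
    ¬(¬S p (p + q) ∧ ¬S (p + q) q ∧ ¬S q (-p))

lemma Nonpure.compl {S : ℤ × ℤ → ℤ × ℤ → Prop} (h : Nonpure S) :
    Nonpure (fun p q => ¬S p q) := by
  intro p q hd
  have := h p q hd
  simp only [not_not]
  exact ⟨this.2, this.1⟩

namespace IsState

variable {S : ℤ × ℤ → ℤ × ℤ → Prop} {c : Config}

lemma rot (hS : IsSign S) (h : IsState S c) : IsState (fun p q => ¬S p q) c.rot where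
  chainA := h.chainB
  chainB := by
    rw [Config.B_rot, List.isChain_map]
    refine h.chainA.imp fun p q hpq => ?_
    have : det p q ^ 2 = 1 := by rw [hpq.1]; norm_num
    rw [hS.neg_neg this, not_not, det_neg_left, det_neg_right, neg_neg]
    exact hpq
  ord := by
    have h1 := h.ord
    have e : c.A ++ c.M = (c.x :: c.L) ++ (c.y :: c.M) := by simp [Config.A]
    have e' : c.rot.A ++ c.rot.M = (c.y :: c.M) ++ (c.x :: c.L).map Neg.neg := by
      simp [Config.A, Config.rot]
    rw [e, List.pairwise_append] at h1
    rw [e', List.pairwise_append]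
    refine ⟨h1.2.1, ?_, ?_⟩
    · rw [List.pairwise_map]
      refine h1.1.imp fun {p q} hpq => ?_
      rwa [det_neg_left, det_neg_right, neg_neg]
    · intro p hp q hq
      obtain ⟨r, hr, rfl⟩ := List.mem_map.1 hq
      rw [det_neg_right, ← det_swap]
      exact h1.2.2 r hr p hp

lemma rot' (hS : IsSign S) (h : IsState (fun p q => ¬S p q) c) : IsState S c.rot := by
  simpa only [not_not] using h.rot hS.compl

lemma exists_node (h : IsState S c) (u : ℤ × ℤ) : ∃ p q, c.Node p q ∧ det p q = 1 ∧
    0 ≤ det p u ∧ det q u ≤ 0 := by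
  have key : ∀ u, 0 ≤ det c.x u → ∃ p q, (Adj c.A p q ∨ Adj c.B p q) ∧ det p q = 1 ∧
      0 ≤ det p u ∧ det q u ≤ 0 := by
    intro u hu
    rcases le_total (det c.y u) 0 with hy | hy
    · obtain ⟨p, q, h1, h2, h3⟩ := exists_adj_sign_change (f := fun z => det z u) c.L c.x c.y hu hy
      exact ⟨p, q, Or.inl h1, (Adj.rel h1 h.chainA).1, h2, h3⟩
    · obtain ⟨p, q, h1, h2, h3⟩ := exists_adj_sign_change (f := fun z => det z u) c.M c.y (-c.x) hy
        (by rw [det_neg_left]; omega)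
      exact ⟨p, q, Or.inr h1, (Adj.rel h1 h.chainB).1, h2, h3⟩
  rcases le_total 0 (det c.x u) with hu | hu
  · obtain ⟨p, q, h1, h2⟩ := key u hu
    refine ⟨p, q, ?_, h2⟩
    unfold Config.Node
    tauto
  · obtain ⟨p, q, h1, h2, h3⟩ := key (-u) (by rw [det_neg_right]; omega)
    refine ⟨-p, -q, ?_, ?_, ?_⟩
    · unfold Config.Node
      rw [neg_neg, neg_neg]
      tauto
    · rw [det_neg_left, det_neg_right, neg_neg, h2]
    · rwa [det_neg_left, det_neg_left, ← det_neg_right, ← det_neg_right]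

end IsState

/-- Insertion between two consecutive entries of a chain keeps its end points. -/
lemma exists_insert {x y p q : ℤ × ℤ} {L X Y : List (ℤ × ℤ)} (m : ℤ × ℤ)
    (h : x :: (L ++ [y]) = X ++ p :: q :: Y) :
    ∃ L', x :: (L' ++ [y]) = X ++ p :: m :: q :: Y := by
  rcases X with _ | ⟨x', X⟩
  · simp only [List.nil_append, List.cons.injEq] at h ⊢
    exact ⟨m :: L, h.1, by rw [List.cons_append, h.2]⟩
  · simp only [List.cons_append, List.cons.injEq] at h ⊢
    obtain ⟨rfl, h⟩ := h
    rcases List.eq_nil_or_concat Y with rfl | ⟨Y, z, rfl⟩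
    · have e : L ++ [y] = (X ++ [p]) ++ [q] := by simpa using h
      obtain ⟨rfl, e2⟩ := List.append_inj' e rfl
      obtain rfl : y = q := by simpa using e2
      exact ⟨X ++ [p, m], rfl, by simp⟩
    · have e : L ++ [y] = (X ++ p :: q :: Y) ++ [z] := by simpa using h
      obtain ⟨rfl, e2⟩ := List.append_inj' e rfl
      obtain rfl : y = z := by simpa using e2
      exact ⟨X ++ p :: m :: q :: Y, rfl, by simp⟩

namespace IsState

variable {S : ℤ × ℤ → ℤ × ℤ → Prop} {c : Config}

lemma refine_inner (h : IsState S c) {p q : ℤ × ℤ}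
    (hA : Adj c.A p q) (h1 : S p (p + q)) (h2 : S (p + q) q) :
    ∃ c', IsState S c' ∧ (∀ u, c.Vtx u → c'.Vtx u) ∧ c'.Node p (p + q) ∧ c'.Node (p + q) q := by
  have hd : det p q = 1 := (hA.rel h.chainA).1
  obtain ⟨X, Y, e⟩ := hA
  obtain ⟨L', e'⟩ := exists_insert (p + q) e
  have eA : (⟨c.x, c.y, L', c.M⟩ : Config).A = X ++ p :: (p + q) :: q :: Y := e'
  have hp : det p (p + q) = 1 := by rw [det_add_right, det_self, hd]; rfl
  have hq : det (p + q) q = 1 := by rw [det_add_left, det_self, hd]; rfl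
  refine ⟨⟨c.x, c.y, L', c.M⟩, ⟨?_, h.chainB, ?_⟩, Config.vtx_mono ?_ ?_, ?_, ?_⟩
  · have hc := h.chainA
    rw [e, List.isChain_append_cons_cons] at hc
    rw [eA, List.isChain_append_cons_cons, List.isChain_cons_cons]
    exact ⟨hc.1, ⟨hp, h1⟩, ⟨hq, h2⟩, hc.2.2⟩
  · have ho := h.ord
    rw [e] at ho
    rw [eA]
    simp only [List.append_assoc, List.cons_append, List.pairwise_append, List.pairwise_cons,
      List.mem_cons, List.mem_append] at ho ⊢
    obtain ⟨oX, ⟨op, oq, oY⟩, oc⟩ := ho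
    refine ⟨oX, ⟨?_, ?_, oq, oY⟩, ?_⟩
    · rintro b (rfl | hb)
      · omega
      · exact op b hb
    · rintro b (rfl | hb)
      · omega
      · rw [det_add_left]
        exact add_pos (op b (Or.inr hb)) (oq b hb)
    · rintro a ha b (rfl | rfl | hb)
      · exact oc a ha b (Or.inl rfl)
      · rw [det_add_right]
        exact add_pos (oc a ha p (Or.inl rfl)) (oc a ha q (Or.inr (Or.inl rfl)))
      · exact oc a ha b (Or.inr hb)
  · intro u hu
    refine Or.inl ?_
    rw [e] at hu
    rw [eA]
    simp only [List.mem_append, List.mem_cons] at hu ⊢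
    tauto
  · exact fun u hu => Or.inr (Or.inr (Or.inl hu))
  · exact Or.inl ⟨X, q :: Y, eA⟩
  · exact Or.inl ⟨X ++ [p], Y, by rw [eA]; simp⟩

lemma refine_first (hS : IsSign S) (h : IsState S c) {p q : ℤ × ℤ}
    (hA : Adj c.A p q) (h1 : ¬S p (p + q)) (h2 : S (p + q) q) :
    ∃ c', IsState S c' ∧ (∀ u, c.Vtx u → c'.Vtx u) ∧ c'.Node p (p + q) ∧ c'.Node (p + q) q := by
  have hd : det p q = 1 := (hA.rel h.chainA).1
  have hpq : S p q := (hA.rel h.chainA).2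
  obtain ⟨X, Y, e⟩ := hA
  have hp : det p (p + q) = 1 := by rw [det_add_right, det_self, hd]; rfl
  have hq : det (p + q) q = 1 := by rw [det_add_left, det_self, hd]; rfl
  rcases List.eq_nil_or_concat X with rfl | ⟨X, r, rfl⟩
  · obtain ⟨x, y, L, M⟩ := c
    simp only [Config.A, List.nil_append, List.cons.injEq] at e
    obtain ⟨rfl, e⟩ := e
    have ho := h.ord
    have hc := h.chainA
    have hb := h.chainB
    simp only [Config.A, Config.B, e, List.cons_append] at ho hc hb
    refine ⟨⟨x + q, y, L, M ++ [-x]⟩, ⟨?_, ?_, ?_⟩, Config.vtx_mono ?_ ?_, ?_, ?_⟩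
    · simp only [Config.A, e]
      rw [List.isChain_cons_cons] at hc ⊢
      exact ⟨⟨hq, h2⟩, hc.2⟩
    · have e3 : (⟨x + q, y, L, M ++ [-x]⟩ : Config).B = (y :: M) ++ -x :: -(x + q) :: [] := by
        simp [Config.B]
      rw [e3, List.isChain_append_cons_cons]
      refine ⟨hb, ⟨?_, ?_⟩, List.isChain_singleton _⟩
      · rw [det_neg_left, det_neg_right, neg_neg, hp]
      · rwa [hS.neg_neg (by rw [hp]; norm_num)]
    · have e3 : (⟨x + q, y, L, M ++ [-x]⟩ : Config).A ++ (M ++ [-x]) =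
          (x + q) :: ((q :: (Y ++ M)) ++ [-x]) := by simp [Config.A, e]
      rw [List.pairwise_cons] at ho
      rw [e3, List.pairwise_cons, List.pairwise_append]
      have hoq := (List.pairwise_cons.1 ho.2).1
      refine ⟨?_, ho.2, List.pairwise_singleton _ _, ?_⟩
      · intro b hb
        rw [List.mem_append, List.mem_cons, List.mem_singleton] at hb
        rcases hb with (rfl | hb) | rfl
        · omega
        · rw [det_add_left]
          exact add_pos (ho.1 b (List.mem_cons_of_mem _ hb)) (hoq b hb)
        · rw [det_neg_right, ← det_swap]; omega
      · intro a ha b hb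
        rw [List.mem_singleton] at hb
        rw [hb, det_neg_right, ← det_swap]
        exact ho.1 a ha
    · intro u hu
      simp only [Config.A, e, List.mem_cons] at hu
      simp only [Config.Vtx, Config.A, Config.B, e, List.mem_cons, List.mem_append]
      rcases hu with rfl | rfl | hu <;> simp_all
    · intro u hu
      simp only [Config.B, List.mem_cons, List.mem_append] at hu
      simp only [Config.Vtx, Config.B, List.mem_cons, List.mem_append]
      tauto
    · exact Or.inr (Or.inr (Or.inr ⟨y :: M, [], by simp [Config.B]⟩))
    · exact Or.inl ⟨[], Y, by simp [Config.A, e]⟩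
  · exfalso
    have e3 : c.A = X ++ r :: p :: q :: Y := by rw [e]; simp
    obtain ⟨hrd, hrp⟩ := Adj.rel (p := r) (q := p) ⟨X, q :: Y, e3⟩ h.chainA
    have ho := h.ord
    rw [e3] at ho
    simp only [List.append_assoc, List.cons_append, List.pairwise_append, List.pairwise_cons,
      List.mem_cons] at ho
    have hk : 0 < det r q := ho.2.1.1 q (Or.inr (Or.inl rfl))
    have eq1 := eq_comb_of_det hrd q
    rw [det_swap p q, hd] at eq1
    set k := det r q
    have eq2 : q = -r + k • p := by rw [eq1]; module
    have h0 : ¬S p (-r + (0 : ℤ) • p) := by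
      rw [zero_smul, add_zero, hS.neg_right (by rw [det_swap, hrd]; norm_num), not_not]
      exact hS.symm _ _ hrp
    have h3 : ¬S p (-r + (k + 1) • p) := by
      have : -r + (k + 1) • p = p + q := by rw [eq2]; module
      rwa [this]
    refine hS.compl.fan p (-r) 0 k (k + 1) ?_ hk (by omega) h0 h3 (by rwa [← eq2])
    rw [det_neg_right, ← det_swap, hrd]; norm_num

lemma refine_last (hS : IsSign S) (h : IsState S c) {p q : ℤ × ℤ}
    (hA : Adj c.A p q) (h1 : S p (p + q)) (h2 : ¬S (p + q) q) :
    ∃ c', IsState S c' ∧ (∀ u, c.Vtx u → c'.Vtx u) ∧ c'.Node p (p + q) ∧ c'.Node (p + q) q := by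
  have hd : det p q = 1 := (hA.rel h.chainA).1
  have hpq : S p q := (hA.rel h.chainA).2
  obtain ⟨X, Y, e⟩ := hA
  have hp : det p (p + q) = 1 := by rw [det_add_right, det_self, hd]; rfl
  have hq : det (p + q) q = 1 := by rw [det_add_left, det_self, hd]; rfl
  rcases Y with _ | ⟨r, Y⟩
  · obtain ⟨x, y, L, M⟩ := c
    have e1 : (x :: L) ++ [y] = (X ++ [p]) ++ [q] := by simpa [Config.A] using e
    obtain ⟨e3, e2⟩ := List.append_inj' e1 rfl
    obtain rfl : y = q := by simpa using e2
    have ho := h.ord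
    have hc := h.chainA
    have hb := h.chainB
    have eA : ∀ z N, (⟨x, z, L, N⟩ : Config).A = X ++ p :: z :: [] := fun z N => by
      have : (⟨x, z, L, N⟩ : Config).A = (x :: L) ++ [z] := rfl
      rw [this, e3]
      simp
    rw [eA] at ho hc
    refine ⟨⟨x, p + y, L, y :: M⟩, ⟨?_, ?_, ?_⟩, Config.vtx_mono ?_ ?_, ?_, ?_⟩
    · rw [eA]
      rw [List.isChain_append_cons_cons] at hc ⊢
      exact ⟨hc.1, ⟨hp, h1⟩, List.isChain_singleton _⟩
    · exact List.isChain_cons_cons.2 ⟨⟨hq, h2⟩, hb⟩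
    · rw [eA]
      simp only [List.append_assoc, List.cons_append, List.pairwise_append, List.pairwise_cons,
        List.mem_cons, List.nil_append] at ho ⊢
      obtain ⟨oX, ⟨op, oq, oY⟩, oc⟩ := ho
      refine ⟨oX, ⟨?_, ?_, oq, oY⟩, ?_⟩
      · rintro b (rfl | hb)
        · omega
        · exact op b hb
      · rintro b (rfl | hb)
        · omega
        · rw [det_add_left]
          exact add_pos (op b (Or.inr hb)) (oq b hb)
      · rintro a ha b (rfl | rfl | hb)
        · exact oc a ha b (Or.inl rfl)
        · rw [det_add_right]
          exact add_pos (oc a ha p (Or.inl rfl)) (oc a ha y (Or.inr (Or.inl rfl)))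
        · exact oc a ha b (Or.inr hb)
    · intro u hu
      rw [eA] at hu
      unfold Config.Vtx
      rw [eA]
      simp only [Config.B, List.mem_append, List.mem_cons] at hu ⊢
      tauto
    · intro u hu
      refine Or.inr (Or.inr (Or.inl ?_))
      simp only [Config.B, List.mem_cons, List.mem_append] at hu ⊢
      tauto
    · exact Or.inl ⟨X, [], eA _ _⟩
    · exact Or.inr (Or.inr (Or.inl ⟨[], M ++ [-x], rfl⟩))
  · exfalso
    have e3 : c.A = (X ++ [p]) ++ q :: r :: Y := by rw [e]; simp
    obtain ⟨hqd, hqr⟩ := Adj.rel (p := q) (q := r) ⟨X ++ [p], Y, e3⟩ h.chainA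
    have ho := h.ord
    rw [e] at ho
    simp only [List.append_assoc, List.cons_append, List.pairwise_append, List.pairwise_cons,
      List.mem_cons] at ho
    have hk : 0 < det p r := ho.2.1.1 r (Or.inr (Or.inl rfl))
    have eq1 := eq_comb_of_det hd r
    rw [det_swap q r, hqd] at eq1
    set k := det p r
    have eq2 : r = -p + k • q := by rw [eq1]; module
    have hdq : det q (-p) ^ 2 = 1 := by rw [det_neg_right, ← det_swap, hd]; norm_num
    have h0 : S q (-p + (-1 : ℤ) • q) := by
      have : -p + (-1 : ℤ) • q = -(p + q) := by module
      rw [this, hS.neg_right (by rw [det_swap, hq]; norm_num)]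
      exact fun h' => h2 (hS.symm _ _ h')
    have h3 := hS.fan q (-p) (-1) 0 k hdq (by norm_num) hk h0 (by rwa [← eq2])
    rw [zero_smul, add_zero, hS.neg_right (by rw [det_swap, hd]; norm_num)] at h3
    exact h3 (hS.symm _ _ hpq)

lemma refine_A (hS : IsSign S) (hN : Nonpure S) (h : IsState S c) {p q : ℤ × ℤ}
    (hA : Adj c.A p q) :
    ∃ c', IsState S c' ∧ (∀ u, c.Vtx u → c'.Vtx u) ∧ c'.Node p (p + q) ∧ c'.Node (p + q) q := by
  by_cases h1 : S p (p + q) <;> by_cases h2 : S (p + q) q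
  · exact h.refine_inner hA h1 h2
  · exact h.refine_last hS hA h1 h2
  · exact h.refine_first hS hA h1 h2
  · exfalso
    obtain ⟨hd, hpq⟩ := hA.rel h.chainA
    refine (hN p q hd).2 ⟨h1, h2, ?_⟩
    rw [hS.neg_right (by rw [det_swap, hd]; norm_num), not_not]
    exact hS.symm _ _ hpq

lemma refine_node (hS : IsSign S) (hN : Nonpure S) (h : IsState S c) {p q : ℤ × ℤ}
    (hA : c.Node p q) :
    ∃ c', IsState S c' ∧ (∀ u, c.Vtx u → c'.Vtx u) ∧ c'.Node p (p + q) ∧ c'.Node (p + q) q := by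
  have key : ∀ p q, Adj c.A p q ∨ Adj c.B p q → ∃ c', IsState S c' ∧
      (∀ u, c.Vtx u → c'.Vtx u) ∧ c'.Node p (p + q) ∧ c'.Node (p + q) q := by
    rintro p q (hA | hB)
    · exact h.refine_A hS hN hA
    · obtain ⟨c', h1, h2, h3, h4⟩ := (h.rot hS).refine_A hS.compl hN.compl hB
      exact ⟨c'.rot, h1.rot' hS, fun u hu => Config.vtx_rot.2 (h2 u (Config.vtx_rot.2 hu)),
        h3.rot, h4.rot⟩
  have key' : Adj c.A (-p) (-q) ∨ Adj c.B (-p) (-q) → ∃ c', IsState S c' ∧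
      (∀ u, c.Vtx u → c'.Vtx u) ∧ c'.Node p (p + q) ∧ c'.Node (p + q) q := by
    intro hh
    obtain ⟨c', h1, h2, h3, h4⟩ := key _ _ hh
    refine ⟨c', h1, h2, ?_, ?_⟩
    · simpa [add_comm] using h3.neg
    · simpa [add_comm] using h4.neg
  rcases hA with hA | hA | hA | hA
  · exact key p q (Or.inl hA)
  · exact key' (Or.inl hA)
  · exact key p q (Or.inr hA)
  · exact key' (Or.inr hA)

lemma exists_vtx_of_node (hS : IsSign S) (hN : Nonpure S) (n : ℕ) :
    ∀ (c : Config), IsState S c → ∀ (p q : ℤ × ℤ) (i j : ℕ), i + j ≤ n → c.Node p q →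
    (∃ v, det ((i : ℤ) • p + (j : ℤ) • q) v = 1) →
    ∃ c', IsState S c' ∧ (∀ u, c.Vtx u → c'.Vtx u) ∧ c'.Vtx ((i : ℤ) • p + (j : ℤ) • q) := by
  induction n with
  | zero =>
    rintro c h p q i j hij hpq ⟨v, hv⟩
    obtain rfl : i = 0 := by omega
    obtain rfl : j = 0 := by omega
    simp [det] at hv
  | succ n ih =>
    rintro c h p q i j hij hpq ⟨v, hv⟩
    have one : ∀ (k : ℕ) (w : ℤ × ℤ), det ((k : ℤ) • w) v = 1 → k = 1 := by
      intro k w hk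
      rw [det_smul_left] at hk
      have := Int.isUnit_iff.1 (IsUnit.of_mul_eq_one _ hk)
      omega
    rcases Nat.eq_zero_or_pos i with rfl | hi
    · have hv' := hv
      rw [Nat.cast_zero, zero_smul, zero_add] at hv'
      obtain rfl := one _ _ hv'
      exact ⟨c, h, fun _ hu => hu, by simpa using hpq.vtx_right⟩
    rcases Nat.eq_zero_or_pos j with rfl | hj
    · have hv' := hv
      rw [Nat.cast_zero, zero_smul, add_zero] at hv'
      obtain rfl := one _ _ hv'
      exact ⟨c, h, fun _ hu => hu, by simpa using hpq.vtx_left⟩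
    obtain ⟨c', h', hmono, h1, h2⟩ := h.refine_node hS hN hpq
    rcases le_total j i with hji | hij'
    · have e : ((i : ℤ) • p + (j : ℤ) • q) = ((i - j : ℕ) : ℤ) • p + (j : ℤ) • (p + q) := by
        push_cast [hji]; module
      rw [e] at hv ⊢
      obtain ⟨c'', k1, k2, k3⟩ := ih c' h' p (p + q) (i - j) j (by omega) h1 ⟨v, hv⟩
      exact ⟨c'', k1, fun u hu => k2 u (hmono u hu), k3⟩
    · have e : ((i : ℤ) • p + (j : ℤ) • q) = (i : ℤ) • (p + q) + ((j - i : ℕ) : ℤ) • q := by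
        push_cast [hij']; module
      rw [e] at hv ⊢
      obtain ⟨c'', k1, k2, k3⟩ := ih c' h' (p + q) q i (j - i) (by omega) h2 ⟨v, hv⟩
      exact ⟨c'', k1, fun u hu => k2 u (hmono u hu), k3⟩

lemma exists_vtx (hS : IsSign S) (hN : Nonpure S) (h : IsState S c) {u : ℤ × ℤ}
    (hu : ∃ v, det u v = 1) :
    ∃ c', IsState S c' ∧ (∀ u, c.Vtx u → c'.Vtx u) ∧ c'.Vtx u := by
  obtain ⟨p, q, hpq, hd, h1, h2⟩ := h.exists_node u
  have e := eq_comb_of_det hd u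
  obtain ⟨j, hj⟩ := Int.eq_ofNat_of_zero_le h1
  obtain ⟨i, hi⟩ := Int.eq_ofNat_of_zero_le (a := det u q) (by rw [det_swap]; omega)
  rw [hi, hj] at e
  rw [e] at hu ⊢
  exact exists_vtx_of_node hS hN (i + j) c h p q i j le_rfl hpq hu

end IsState

lemma exists_isState {S : ℤ × ℤ → ℤ × ℤ → Prop} (hS : IsSign S) : ∃ c, IsState S c := by
  have key : ∀ p q, det p q = 1 → S p q → ∃ c, IsState S c := by
    intro p q hd h
    refine ⟨⟨p, q, [], []⟩, ?_, ?_, ?_⟩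
    · simp [Config.A, hd, h]
    · have : det q p ^ 2 = 1 := by rw [det_swap, hd]; norm_num
      simp only [Config.B, List.nil_append, List.isChain_cons_cons, List.isChain_singleton,
        and_true, hS.neg_right this, not_not]
      exact ⟨by rw [det_neg_right, ← det_swap, hd], hS.symm _ _ h⟩
    · simp [Config.A, hd]
  by_cases h : S (1, 0) (0, 1)
  · exact key _ _ (by simp [det]) h
  · refine key (0, 1) (-(1, 0)) (by simp [det]) ?_
    rw [hS.neg_right (by simp [det])]
    exact fun h' => h (hS.symm _ _ h')

lemma exists_isState_vtx {S : ℤ × ℤ → ℤ × ℤ → Prop} (hS : IsSign S) (hN : Nonpure S)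
    (F : Finset (ℤ × ℤ)) (hF : ∀ u ∈ F, ∃ v, det u v = 1) :
    ∃ c, IsState S c ∧ ∀ u ∈ F, c.Vtx u := by
  induction F using Finset.induction_on with
  | empty =>
    obtain ⟨c, hc⟩ := exists_isState hS
    exact ⟨c, hc, by simp⟩
  | insert a F _ ih =>
    obtain ⟨c, hc, h⟩ := ih fun u hu => hF u (Finset.mem_insert_of_mem hu)
    obtain ⟨c', hc', h1, h2⟩ := hc.exists_vtx hS hN (hF a (Finset.mem_insert_self _ _))
    refine ⟨c', hc', fun u hu => ?_⟩
    rcases Finset.mem_insert.1 hu with rfl | hu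
    · exact h2
    · exact h1 u (h u hu)

namespace IsSign

variable {S : ℤ × ℤ → ℤ × ℤ → Prop}

/-- The end points of a chain of chosen roots span a chosen root, if they form a basis. -/
lemma rel_of_chain (hS : IsSign S) (hN : Nonpure S) (n : ℕ) :
    ∀ (T : List (ℤ × ℤ)) (u v : ℤ × ℤ), T.length ≤ n → det u v = 1 →
    (u :: (T ++ [v])).IsChain (fun p q => det p q = 1 ∧ S p q) →
    (u :: (T ++ [v])).Pairwise (fun p q => 0 < det p q) → S u v := by
  induction n with
  | zero =>
    intro T u v hT hd hc _
    obtain rfl : T = [] := List.length_eq_zero_iff.1 (by omega)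
    exact (Adj.rel (p := u) (q := v) ⟨[], [], rfl⟩ hc).2
  | succ n ih =>
    intro T u v hT hd hc ho
    have hmu : det u (u + v) = 1 := by rw [det_add_right, det_self, hd]; rfl
    have hmv : det (u + v) v = 1 := by rw [det_add_left, det_self, hd]; rfl
    obtain ⟨p, q, hpq, h1, h2⟩ := exists_adj_sign_change (f := fun z => det z (u + v)) T u v
      (by rw [hmu]; norm_num) (by rw [det_swap, hmv]; norm_num)
    obtain ⟨hpqd, hSpq⟩ := hpq.rel hc
    have nonneg : ∀ z ∈ u :: (T ++ [v]), 0 ≤ det u z ∧ 0 ≤ det z v := by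
      intro z hz
      have ho' : (u :: T ++ [v]).Pairwise (fun p q => 0 < det p q) := ho
      rw [List.pairwise_append] at ho'
      refine ⟨?_, ?_⟩
      · rcases List.mem_cons.1 hz with rfl | hz
        · rw [det_self]
        · exact ((List.pairwise_cons.1 ho).1 z hz).le
      · have hz' : z ∈ (u :: T) ++ [v] := hz
        rcases List.mem_append.1 hz' with hz' | hz'
        · exact (ho'.2.2 z hz' v (List.mem_singleton.2 rfl)).le
        · rw [List.mem_singleton.1 hz', det_self]
    obtain ⟨hp1, hp2⟩ := nonneg p hpq.mem_left
    obtain ⟨hq1, hq2⟩ := nonneg q hpq.mem_right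
    have split : u + v ∈ T → S u v := by
      intro hm
      obtain ⟨X, Y, rfl⟩ := List.append_of_mem hm
      rw [List.length_append, List.length_cons] at hT
      have e : u :: ((X ++ (u + v) :: Y) ++ [v]) = (u :: X) ++ (u + v) :: (Y ++ [v]) := by simp
      rw [e] at hc ho
      have hc2 := List.isChain_split.1 hc
      have ho2 := List.pairwise_append.1 ho
      have s1 : S u (u + v) := ih X u (u + v) (by omega) hmu hc2.1
        (ho.sublist (by simp))
      have s2 : S (u + v) v := ih Y (u + v) v (by omega) hmv hc2.2 ho2.2.1
      by_contra hcon
      refine (hN u v hd).1 ⟨s1, s2, ?_⟩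
      rw [hS.neg_right (by rw [det_swap, hd]; norm_num)]
      exact fun h' => hcon (hS.symm _ _ h')
    have mem_T : u + v ∈ u :: (T ++ [v]) → u + v ∈ T := by
      intro hm
      rw [List.mem_cons, List.mem_append, List.mem_singleton] at hm
      rcases hm with hm | hm | hm
      · rw [hm, det_self] at hmu; omega
      · exact hm
      · rw [hm, det_self] at hmv; omega
    have ep := eq_comb_of_det hd p
    have eq := eq_comb_of_det hd q
    have hdet : det p v * det u q - det u p * det q v = 1 := by
      rw [ep, eq, det_comb, hd, mul_one] at hpqd
      linarith
    have hip : det p (u + v) = det p v - det u p := by rw [det_add_right, det_swap u p]; ring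
    have hiq : det q (u + v) = det q v - det u q := by rw [det_add_right, det_swap u q]; ring
    simp only [hip, hiq] at h1 h2
    -- with `a, b, c, d ≥ 0`, `a d - b c = 1`, `b ≤ a`, `c ≤ d`
    generalize det p v = a at *
    generalize det u p = b at *
    generalize det q v = c at *
    generalize det u q = d at *
    rcases h1.eq_or_lt with hab | hab
    · obtain rfl : a = b := by omega
      have ha : a = 1 := by
        have : a * (d - c) = 1 := by linarith
        rcases Int.isUnit_iff.1 (IsUnit.of_mul_eq_one _ this) with h | h <;> omega
      refine split (mem_T ?_)
      have := hpq.mem_left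
      rwa [ep, ha, one_smul, one_smul] at this
    · rcases h2.eq_or_lt with hcd | hcd
      · obtain rfl : c = d := by omega
        have hc1 : c = 1 := by
          have : c * (a - b) = 1 := by linarith
          rcases Int.isUnit_iff.1 (IsUnit.of_mul_eq_one _ this) with h | h <;> omega
        refine split (mem_T ?_)
        have := hpq.mem_right
        rwa [eq, hc1, one_smul, one_smul] at this
      · have hb : b = 0 := by nlinarith
        have hc1 : c = 0 := by nlinarith
        subst hb hc1
        have had : a * d = 1 := by linarith
        have ha : a = 1 := by
          rcases Int.isUnit_iff.1 (IsUnit.of_mul_eq_one _ had) with h | h <;> omega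
        subst ha
        obtain rfl : d = 1 := by linarith
        rw [ep, eq] at hSpq
        simpa using hSpq

lemma rel_of_mem_chain (hS : IsSign S) (hN : Nonpure S) {l : List (ℤ × ℤ)}
    (hc : l.IsChain (fun p q => det p q = 1 ∧ S p q))
    (ho : l.Pairwise (fun p q => 0 < det p q)) {u v : ℤ × ℤ} (hu : u ∈ l) (hv : v ∈ l)
    (hd : det u v = 1) : S u v := by
  obtain ⟨X, Y, rfl⟩ := List.append_of_mem hu
  rw [List.mem_append, List.mem_cons] at hv
  rcases hv with hv | rfl | hv
  · have := (List.pairwise_append.1 ho).2.2 v hv u List.mem_cons_self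
    rw [det_swap] at this
    omega
  · rw [det_self] at hd; omega
  · obtain ⟨Y, Z, rfl⟩ := List.append_of_mem hv
    have hi : u :: (Y ++ [v]) <:+: X ++ u :: (Y ++ v :: Z) := ⟨X, Z, by simp⟩
    exact hS.rel_of_chain hN _ Y u v le_rfl hd (hc.infix hi) (ho.sublist hi.sublist)

end IsSign

namespace Config

/-- Twice the polarization of the quadratic form vanishing at the two end directions. -/
def form (c : Config) (z z' : ℤ × ℤ) : ℤ :=
  det c.x z * det z' c.y + det c.x z' * det z c.y

lemma form_rot (c : Config) (z z' : ℤ × ℤ) : c.rot.form z z' = -c.form z z' := by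
  simp only [form, rot, det_neg_right]
  rw [det_swap z c.y, det_swap z' c.y, det_swap c.x z, det_swap c.x z']
  ring

lemma form_neg_left (c : Config) (z z' : ℤ × ℤ) : c.form (-z) z' = -c.form z z' := by
  simp only [form, det_neg_left, det_neg_right]; ring

lemma form_comm (c : Config) (z z' : ℤ × ℤ) : c.form z z' = c.form z' z := by
  unfold form; ring

lemma form_neg_neg (c : Config) (z z' : ℤ × ℤ) : c.form (-z) (-z') = c.form z z' := by
  rw [form_neg_left, form_comm, form_neg_left, form_comm, neg_neg]

end Config

namespace IsState

variable {S : ℤ × ℤ → ℤ × ℤ → Prop} {c : Config}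

lemma pos_of_mem (h : IsState S c) {u : ℤ × ℤ} (hu : u ∈ c.L) :
    0 < det c.x u ∧ 0 < det u c.y := by
  have ho := (List.pairwise_append.1 h.ord).1
  unfold Config.A at ho
  rw [List.pairwise_cons, List.pairwise_append] at ho
  exact ⟨ho.1 u (List.mem_append_left _ hu), ho.2.2.2 u hu _ (List.mem_singleton.2 rfl)⟩

lemma mem_of_form_pos (hS : IsSign S) (h : IsState S c) {u : ℤ × ℤ} (hu : c.Vtx u)
    (hf : 0 < c.form u u) : u ∈ c.L ∨ -u ∈ c.L := by
  have keyA : ∀ u ∈ c.A, 0 < c.form u u → u ∈ c.L := by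
    intro u hu hf
    simp only [Config.A, List.mem_cons, List.mem_append, List.not_mem_nil, or_false] at hu
    rcases hu with rfl | hu | rfl
    · simp [Config.form, det_self] at hf
    · exact hu
    · simp [Config.form, det_self] at hf
  have keyB : ∀ u ∈ c.B, ¬0 < c.form u u := by
    intro u hu hf
    simp only [Config.B, List.mem_cons, List.mem_append, List.not_mem_nil, or_false] at hu
    rcases hu with rfl | hu | rfl
    · simp [Config.form, det_self] at hf
    · have := (h.rot hS).pos_of_mem (u := u) hu
      have h2 := c.form_rot u u
      have h3 : 0 < c.rot.form u u := by
        unfold Config.form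
        exact add_pos (mul_pos this.1 this.2) (mul_pos this.1 this.2)
      omega
    · simp [Config.form, det_self, det_neg_right] at hf
  rcases hu with hu | hu | hu | hu
  · exact Or.inl (keyA u hu hf)
  · exact Or.inr (keyA (-u) hu (by rwa [Config.form_neg_neg]))
  · exact absurd hf (keyB u hu)
  · exact absurd (by rwa [Config.form_neg_neg]) (keyB (-u) hu)

lemma up_of_mem (hS : IsSign S) (h : IsState S c) {u : ℤ × ℤ} (hu : u ∈ c.L) : Up S u := by
  obtain ⟨X, Y, e⟩ := List.append_of_mem hu
  have hne : c.x :: X ≠ [] := by simp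
  obtain ⟨X', r, e1⟩ := (List.eq_nil_or_concat (c.x :: X)).resolve_left hne
  obtain ⟨r', Y', e2⟩ := List.exists_cons_of_ne_nil (l := Y ++ [c.y]) (by simp)
  have eA : c.A = X' ++ r :: u :: r' :: Y' := by
    have : c.A = (c.x :: X) ++ u :: (Y ++ [c.y]) := by simp [Config.A, e]
    rw [this, e1, e2]
    simp
  obtain ⟨h1, h2⟩ := Adj.rel (p := r) (q := u) ⟨X', r' :: Y', eA⟩ h.chainA
  obtain ⟨h3, h4⟩ := Adj.rel (p := u) (q := r') ⟨X' ++ [r], Y', by rw [eA]; simp⟩ h.chainA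
  have ho := (List.pairwise_append.1 h.ord).1
  rw [eA] at ho
  have hk : 0 < det r r' :=
    (List.pairwise_cons.1 (List.pairwise_append.1 ho).2.1).1 r' (by simp)
  have e3 := eq_comb_of_det h1 r'
  rw [det_swap u r', h3] at e3
  have e4 : r' = -r + det r r' • u := by
    nth_rw 1 [e3]
    module
  refine hS.up_of_lt (v := -r) (by rw [det_neg_right, ← det_swap, h1]) hk ?_ (by rwa [← e4])
  rw [zero_smul, add_zero, hS.neg_right (by rw [det_swap, h1]; norm_num), not_not]
  exact hS.symm _ _ h2

lemma up_of_form_pos (hS : IsSign S) (h : IsState S c) {u : ℤ × ℤ} (hu : c.Vtx u)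
    (hf : 0 < c.form u u) : Up S u := by
  rcases h.mem_of_form_pos hS hu hf with hm | hm
  · exact h.up_of_mem hS hm
  · simpa using hS.up_neg (h.up_of_mem hS hm)

lemma up_of_form_neg (hS : IsSign S) (h : IsState S c) {u : ℤ × ℤ} (hu : c.Vtx u)
    (hf : c.form u u < 0) : Up (fun p q => ¬S p q) u :=
  (h.rot hS).up_of_form_pos hS.compl (Config.vtx_rot.2 hu) (by rw [Config.form_rot]; omega)

lemma form_nonneg_of_pos (hS : IsSign S) (hN : Nonpure S) (h : IsState S c) {p q : ℤ × ℤ}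
    (hp : c.Vtx p) (hq : c.Vtx q) (hd : det p q = 1) (hpq : S p q) (hfp : 0 < c.form p p)
    (hfq : 0 < c.form q q) : 0 ≤ c.form p q := by
  have pos : ∀ p ∈ c.L, ∀ q ∈ c.L, 0 ≤ c.form p q := by
    intro p hp q hq
    have h1 := h.pos_of_mem hp
    have h2 := h.pos_of_mem hq
    exact (add_pos (mul_pos h1.1 h2.2) (mul_pos h2.1 h1.2)).le
  have sub : ∀ {z}, z ∈ c.L → z ∈ c.A := fun hz =>
    List.mem_cons_of_mem _ (List.mem_append_left _ hz)
  have ho := (List.pairwise_append.1 h.ord).1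
  have hqp : det q p ^ 2 = 1 := by rw [det_swap, hd]; norm_num
  rcases h.mem_of_form_pos hS hp hfp with hp | hp <;>
    rcases h.mem_of_form_pos hS hq hfq with hq | hq
  · exact pos p hp q hq
  · have := hS.rel_of_mem_chain hN h.chainA ho (sub hq) (sub hp)
      (by rw [det_neg_left, ← det_swap, hd])
    rw [hS.neg _ _ hqp] at this
    exact absurd (hS.symm _ _ hpq) this
  · have := hS.rel_of_mem_chain hN h.chainA ho (sub hq) (sub hp)
      (by rw [det_neg_right, ← det_swap, hd])
    rw [hS.neg_right hqp] at this
    exact absurd (hS.symm _ _ hpq) this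
  · have := pos _ hp _ hq
    rwa [Config.form_neg_neg] at this

lemma form_nonneg_of_neg (hS : IsSign S) (hN : Nonpure S) (h : IsState S c) {p q : ℤ × ℤ}
    (hp : c.Vtx p) (hq : c.Vtx q) (hd : det p q = 1) (hpq : S p q) (hfp : c.form p p < 0)
    (hfq : c.form q q < 0) : 0 ≤ c.form p q := by
  have := (h.rot hS).form_nonneg_of_pos hS.compl hN.compl (Config.vtx_rot.2 hq)
    (Config.vtx_rot.2 hp.neg) (by rw [det_neg_right, ← det_swap, hd])
    (by
      rw [hS.neg_right (by rw [det_swap, hd]; norm_num), not_not]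
      exact hS.symm _ _ hpq)
    (by rw [Config.form_rot]; omega) (by rw [Config.form_rot, Config.form_neg_neg]; omega)
  rw [Config.form_rot, Config.form_comm, Config.form_neg_left, neg_neg] at this
  exact this

end IsState

/-- The symmetric bilinear form on `ℤ²` with given coefficients. -/
def bil (w : Fin 3 → ℝ) (z z' : ℤ × ℤ) : ℝ :=
  w 0 * (z.1 * z'.1) + w 1 * (z.1 * z'.2 + z.2 * z'.1) + w 2 * (z.2 * z'.2)

/-- The coefficients of the form of a subdivision. -/
def Config.coef (c : Config) : Fin 3 → ℝ :=
  ![(c.form (1, 0) (1, 0) : ℝ), c.form (1, 0) (0, 1), c.form (0, 1) (0, 1)]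

lemma bil_coef (c : Config) (z z' : ℤ × ℤ) : bil c.coef z z' = c.form z z' := by
  simp [bil, Config.coef, Config.form, det]
  ring

lemma bil_smul (r : ℝ) (w : Fin 3 → ℝ) (z z' : ℤ × ℤ) : bil (r • w) z z' = r * bil w z z' := by
  simp only [bil, Pi.smul_apply, smul_eq_mul]; ring

lemma continuous_bil (z z' : ℤ × ℤ) : Continuous fun w => bil w z z' := by
  unfold bil; fun_prop

lemma bil_comb (w : Fin 3 → ℝ) (p q : ℤ × ℤ) (i j : ℤ) :
    bil w (i • p + j • q) (i • p + j • q) =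
      i ^ 2 * bil w p p + 2 * (i * j) * bil w p q + j ^ 2 * bil w q q := by
  simp only [bil, Prod.fst_add, Prod.snd_add, Prod.smul_fst, Prod.smul_snd, smul_eq_mul]
  push_cast
  ring

lemma IsState.coef_ne_zero {S : ℤ × ℤ → ℤ × ℤ → Prop} {c : Config} (h : IsState S c) :
    c.coef ≠ 0 := by
  intro h0
  have h1 := bil_coef c c.x c.y
  rw [h0] at h1
  have h2 : c.form c.x c.y = 0 := by
    have : (c.form c.x c.y : ℝ) = 0 := by rw [← h1]; simp [bil]
    exact_mod_cast this
  have ho := (List.pairwise_append.1 h.ord).1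
  have hd : 0 < det c.x c.y := (List.pairwise_cons.1 ho).1 c.y (by simp)
  rw [Config.form, det_self, zero_mul, zero_add] at h2
  exact (mul_pos hd hd).ne' h2

/-- A form that is a limit of forms of finer and finer subdivisions. -/
lemma exists_limit_form {S : ℤ × ℤ → ℤ × ℤ → Prop} (hS : IsSign S) (hN : Nonpure S) :
    ∃ w : Fin 3 → ℝ, w ≠ 0 ∧ ∀ (F : Finset (ℤ × ℤ)), (∀ u ∈ F, ∃ v, det u v = 1) →
      ∀ p : (Fin 3 → ℝ) → Prop, (∀ᶠ w' in nhds w, p w') →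
      ∃ c, IsState S c ∧ (∀ u ∈ F, c.Vtx u) ∧ ∃ r : ℝ, 0 < r ∧ p (r • c.coef) := by
  classical
  have hex : ∀ F : Finset {u : ℤ × ℤ // ∃ v, det u v = 1}, ∃ c, IsState S c ∧
      ∀ u ∈ F, c.Vtx u.1 := by
    intro F
    obtain ⟨c, hc, h⟩ := exists_isState_vtx hS hN (F.image Subtype.val) (by
      intro u hu
      obtain ⟨a, -, rfl⟩ := Finset.mem_image.1 hu
      exact a.2)
    exact ⟨c, hc, fun u hu => h _ (Finset.mem_image_of_mem _ hu)⟩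
  choose c hc hv using hex
  obtain ⟨w, hw, hcl⟩ := (isCompact_sphere (0 : Fin 3 → ℝ) 1).exists_mapClusterPt
    (f := Filter.atTop) (u := fun F => ‖(c F).coef‖⁻¹ • (c F).coef) (by
      rw [Filter.le_principal_iff, Filter.mem_map]
      refine Filter.univ_mem' fun F => ?_
      simp [norm_smul, (hc F).coef_ne_zero])
  refine ⟨w, ?_, ?_⟩
  · rintro rfl
    simp at hw
  · intro F hF p hp
    obtain ⟨G, hG, hGp⟩ := (((hcl.frequently hp).and_eventually
      (Filter.eventually_ge_atTop (F.subtype _))).exists)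
    refine ⟨c G, hc G, fun u hu => hv G ⟨u, hF u hu⟩ (hGp (Finset.mem_subtype.2 hu)), _, ?_, hG⟩
    exact inv_pos.2 (norm_pos_iff.2 (hc G).coef_ne_zero)

lemma exists_rat_between {a b c : ℝ} (hb : b < 0) (hac : a * c ≤ 0) :
    ∃ t : ℚ, 0 < t ∧ |a * (t : ℝ) ^ 2 + c| < -2 * b * t := by
  obtain ⟨t, ht, hlt⟩ : ∃ t : ℝ, 0 < t ∧ |a * t ^ 2 + c| < -2 * b * t := by
    rcases eq_or_ne a 0 with rfl | ha
    · refine ⟨|c| / -b + 1, add_pos_of_nonneg_of_pos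
        (div_nonneg (abs_nonneg c) (neg_pos.2 hb).le) one_pos, ?_⟩
      have : |c| / -b * -b = |c| := div_mul_cancel₀ _ (neg_pos.2 hb).ne'
      rw [zero_mul, zero_add]
      nlinarith [abs_nonneg c]
    rcases eq_or_ne c 0 with rfl | hc
    · have ha' := abs_pos.2 ha
      refine ⟨-b / |a|, div_pos (neg_pos.2 hb) ha', ?_⟩
      have hpos := div_pos (neg_pos.2 hb) ha'
      rw [add_zero, abs_mul, abs_of_nonneg (sq_nonneg (-b / |a|)), sq, ← mul_assoc,
        mul_div_cancel₀ _ ha'.ne']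
      nlinarith
    · have hac' : 0 < -c / a := by
        have h1 : a * c < 0 := lt_of_le_of_ne hac (mul_ne_zero ha hc)
        rcases lt_or_gt_of_ne ha with h | h
        · exact div_pos_of_neg_of_neg (by nlinarith) h
        · exact div_pos (by nlinarith) h
      refine ⟨√(-c / a), Real.sqrt_pos.2 hac', ?_⟩
      rw [Real.sq_sqrt hac'.le, mul_div_cancel₀ _ ha, neg_add_cancel, abs_zero]
      have := Real.sqrt_pos.2 hac'
      nlinarith
  have hopen : IsOpen ({t : ℝ | 0 < t} ∩ {t : ℝ | |a * t ^ 2 + c| < -2 * b * t}) :=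
    (isOpen_lt continuous_const continuous_id).inter
      (isOpen_lt (f := fun t : ℝ => |a * t ^ 2 + c|) (g := fun t : ℝ => -2 * b * t)
        (by fun_prop) (by fun_prop))
  obtain ⟨s, hs, hs'⟩ := (Rat.denseRange_cast (𝕜 := ℝ)).exists_mem_open hopen ⟨t, ht, hlt⟩
  have hs0 : (0 : ℝ) < s := hs
  exact ⟨s, Rat.cast_pos.1 hs0, hs'⟩

lemma exists_form_nonneg {S : ℤ × ℤ → ℤ × ℤ → Prop} (hS : IsSign S) (hN : Nonpure S) :
    ∃ w : Fin 3 → ℝ, w ≠ 0 ∧ ∀ p q, det p q = 1 → S p q → 0 ≤ bil w p q := by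
  classical
  obtain ⟨w, hw, hlim⟩ := exists_limit_form hS hN
  have ev_pos : ∀ z z', 0 < bil w z z' → ∀ᶠ w' in nhds w, 0 < bil w' z z' := fun z z' h =>
    (continuous_bil z z').continuousAt.eventually (lt_mem_nhds h)
  have ev_neg : ∀ z z', bil w z z' < 0 → ∀ᶠ w' in nhds w, bil w' z z' < 0 := fun z z' h =>
    (continuous_bil z z').continuousAt.eventually (gt_mem_nhds h)
  have form_pos : ∀ {c : Config} {r : ℝ} {z z'}, 0 < r → 0 < bil (r • c.coef) z z' →
      0 < c.form z z' := by
    intro c r z z' hr h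
    rw [bil_smul, bil_coef] at h
    exact_mod_cast (pos_iff_pos_of_mul_pos h).1 hr
  have form_neg : ∀ {c : Config} {r : ℝ} {z z'}, 0 < r → bil (r • c.coef) z z' < 0 →
      c.form z z' < 0 := by
    intro c r z z' hr h
    rw [bil_smul, bil_coef] at h
    have : (c.form z z' : ℝ) < 0 := by
      by_contra hn
      exact absurd h (not_lt.2 (mul_nonneg hr.le (not_lt.1 hn)))
    exact_mod_cast this
  have up_pos : ∀ u, (∃ v, det u v = 1) → 0 < bil w u u → Up S u := by
    intro u hu h
    obtain ⟨c, hc, hF, r, hr, hp⟩ := hlim {u} (by simpa using hu) _ (ev_pos u u h)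
    exact hc.up_of_form_pos hS (hF u (by simp)) (form_pos hr hp)
  have up_neg : ∀ u, (∃ v, det u v = 1) → bil w u u < 0 → Up (fun a b => ¬S a b) u := by
    intro u hu h
    obtain ⟨c, hc, hF, r, hr, hp⟩ := hlim {u} (by simpa using hu) _ (ev_neg u u h)
    exact hc.up_of_form_neg hS (hF u (by simp)) (form_neg hr hp)
  refine ⟨w, hw, fun p q hd hpq => ?_⟩
  by_contra hb
  rw [not_le] at hb
  have hprim : ∀ u ∈ ({p, q} : Finset (ℤ × ℤ)), ∃ v, det u v = 1 := by
    simp only [Finset.mem_insert, Finset.mem_singleton]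
    rintro u (rfl | rfl)
    · exact ⟨q, hd⟩
    · exact ⟨-p, by rw [det_neg_right, ← det_swap, hd]⟩
  rcases lt_or_ge 0 (bil w p p * bil w q q) with hac | hac
  · rcases pos_and_pos_or_neg_and_neg_of_mul_pos hac with ⟨ha, hc⟩ | ⟨ha, hc⟩
    · obtain ⟨c, hc, hF, r, hr, ⟨h1, h2⟩, h3⟩ := hlim {p, q} hprim _
        (((ev_pos p p ha).and (ev_pos q q hc)).and (ev_neg p q hb))
      have := hc.form_nonneg_of_pos hS hN (hF p (by simp)) (hF q (by simp)) hd hpq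
        (form_pos hr h1) (form_pos hr h2)
      have := form_neg hr h3
      omega
    · obtain ⟨c, hc, hF, r, hr, ⟨h1, h2⟩, h3⟩ := hlim {p, q} hprim _
        (((ev_neg p p ha).and (ev_neg q q hc)).and (ev_neg p q hb))
      have := hc.form_nonneg_of_neg hS hN (hF p (by simp)) (hF q (by simp)) hd hpq
        (form_neg hr h1) (form_neg hr h2)
      have := form_neg hr h3
      omega
  · obtain ⟨t, ht, hlt⟩ := exists_rat_between hb hac
    have hi : 0 < t.num := Rat.num_pos.2 ht
    have hj : 0 < (t.den : ℤ) := by exact_mod_cast t.den_pos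
    have hj' : (0 : ℝ) < t.den := by exact_mod_cast t.den_pos
    have hcop : IsCoprime t.num (t.den : ℤ) := Int.isCoprime_iff_nat_coprime.2 t.reduced
    have ht' : (t.num : ℝ) = t * t.den := by exact_mod_cast (Rat.mul_den_eq_num t).symm
    obtain ⟨hl, hu⟩ := abs_lt.1 hlt
    have hjj : (0 : ℝ) < t.den ^ 2 := by positivity
    obtain ⟨m, n, hmn⟩ := hcop
    refine hS.up_reflect hd hpq hi hj ⟨m, n, hmn⟩ (up_pos _ ?_ ?_) (up_neg _ ?_ ?_)
    · exact ⟨-n • p + -m • q, by rw [det_comb, hd]; linear_combination hmn⟩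
    · rw [bil_comb]
      push_cast
      rw [ht']
      have : 0 < (t.den : ℝ) ^ 2 * (bil w p p * t ^ 2 + bil w q q - 2 * bil w p q * t) :=
        mul_pos hjj (by linarith)
      linarith
    · exact ⟨-n • p + m • q, by rw [det_comb, hd]; linear_combination hmn⟩
    · rw [bil_comb]
      push_cast
      rw [ht']
      have : 0 < (t.den : ℝ) ^ 2 * -(bil w p p * t ^ 2 + bil w q q + 2 * bil w p q * t) :=
        mul_pos hjj (by linarith)
      linarith

lemma eq_zero_or_pos_of_mem_nnspan {X : Set V} (f : V →ₗ[ℝ] ℝ) (hf : ∀ x ∈ X, 0 < f x) {v : V}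
    (hv : v ∈ nnspan X) : v = 0 ∨ 0 < f v := by
  refine Submodule.span_induction (p := fun v _ => v = 0 ∨ 0 < f v) ?_ ?_ ?_ ?_ hv
  · exact fun x hx => Or.inr (hf x hx)
  · exact Or.inl rfl
  · rintro x y _ _ (rfl | hx) (rfl | hy)
    · simp
    · simp [hy]
    · simp [hx]
    · right; rw [map_add]; exact add_pos hx hy
  · rintro r x _ (rfl | hx)
    · simp
    · rcases eq_or_ne r 0 with rfl | hr
      · simp
      · right
        rw [NNReal.smul_def, map_smul]
        exact mul_pos (NNReal.coe_pos.2 (pos_iff_ne_zero.2 hr)) hx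

lemma mem_nnspan_ker {X : Set V} (f : V →ₗ[ℝ] ℝ) (hf : ∀ x ∈ X, 0 ≤ f x) {v : V}
    (hv : v ∈ nnspan X) : 0 ≤ f v ∧ (f v = 0 → v ∈ nnspan {x ∈ X | f x = 0}) := by
  refine Submodule.span_induction
    (p := fun v _ => 0 ≤ f v ∧ (f v = 0 → v ∈ nnspan {x ∈ X | f x = 0})) ?_ ?_ ?_ ?_ hv
  · exact fun x hx => ⟨hf x hx, fun h => Submodule.subset_span ⟨hx, h⟩⟩
  · exact ⟨by simp, fun _ => Submodule.zero_mem _⟩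
  · rintro x y _ _ ⟨hx, hx'⟩ ⟨hy, hy'⟩
    rw [map_add]
    exact ⟨add_nonneg hx hy, fun h =>
      Submodule.add_mem _ (hx' (by linarith)) (hy' (by linarith))⟩
  · rintro r x _ ⟨hx, hx'⟩
    rw [NNReal.smul_def, map_smul]
    refine ⟨mul_nonneg r.2 hx, fun h => ?_⟩
    rcases mul_eq_zero.1 h with h | h
    · rw [h, zero_smul]; exact Submodule.zero_mem _
    · exact Submodule.smul_mem _ r (hx' h)

/-- The triple product with a fixed first vector. -/
def triple (l : V) : V →ₗ[ℝ] V →ₗ[ℝ] ℝ :=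
  LinearMap.mk₂ ℝ (fun x y => l 0 * (x 1 * y 2 - x 2 * y 1) + l 1 * (x 2 * y 0 - x 0 * y 2) +
      l 2 * (x 0 * y 1 - x 1 * y 0))
    (by intros; simp only [Pi.add_apply]; ring)
    (by intros; simp only [Pi.smul_apply, smul_eq_mul]; ring)
    (by intros; simp only [Pi.add_apply]; ring)
    (by intros; simp only [Pi.smul_apply, smul_eq_mul]; ring)

lemma triple_apply (l x y : V) : triple l x y =
    l 0 * (x 1 * y 2 - x 2 * y 1) + l 1 * (x 2 * y 0 - x 0 * y 2) +
      l 2 * (x 0 * y 1 - x 1 * y 0) := rfl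

lemma triple_swap (l x y : V) : triple l y x = -triple l x y := by
  simp only [triple_apply]; ring

/-- Membership in the plane orthogonal to `l`. -/
def InPlane (l x : V) : Prop := l 0 * x 0 + l 1 * x 1 + l 2 * x 2 = 0

lemma triple_relation {l x y z : V} (hl : l ≠ 0) (hx : InPlane l x) (hy : InPlane l y)
    (hz : InPlane l z) : triple l y z • x + triple l z x • y + triple l x y • z = 0 := by
  unfold InPlane at hx hy hz
  have hdet : triple x y z = 0 := by
    by_contra hne
    apply hl
    have h : ∀ i, triple x y z * l i = 0 := by
      intro i
      simp only [triple_apply]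
      fin_cases i <;> simp only [Fin.zero_eta, Fin.mk_one, Fin.reduceFinMk]
      · linear_combination (y 1 * z 2 - y 2 * z 1) * hx + (z 1 * x 2 - z 2 * x 1) * hy +
          (x 1 * y 2 - x 2 * y 1) * hz
      · linear_combination (y 2 * z 0 - y 0 * z 2) * hx + (z 2 * x 0 - z 0 * x 2) * hy +
          (x 2 * y 0 - x 0 * y 2) * hz
      · linear_combination (y 0 * z 1 - y 1 * z 0) * hx + (z 0 * x 1 - z 1 * x 0) * hy +
          (x 0 * y 1 - x 1 * y 0) * hz
    ext i
    exact (mul_eq_zero.1 (h i)).resolve_left hne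
  ext i
  have : triple l y z * x i + triple l z x * y i + triple l x y * z i = triple x y z * l i := by
    simp only [triple_apply]
    fin_cases i <;> simp <;> ring
  simpa [hdet] using this

lemma sum_pos_of_mem_Φpos {x : V} (hx : x ∈ Φpos) : 0 < x 0 + x 1 + x 2 := by
  have h0 := Φpos_nonneg hx 0
  have h1 := Φpos_nonneg hx 1
  have h2 := Φpos_nonneg hx 2
  by_contra hn
  apply Φpos_ne_zero hx
  ext i
  fin_cases i <;> simp <;> linarith

lemma exists_smul_of_triple_eq_zero {l x y : V} (hl : l ≠ 0) (hx : InPlane l x) (hy : InPlane l y)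
    (hxp : x ∈ Φpos) (hyp : y ∈ Φpos) (h : triple l x y = 0) :
    ∃ s : ℝ, 0 ≤ s ∧ y = s • x := by
  have hsx := sum_pos_of_mem_Φpos hxp
  have hsy := sum_pos_of_mem_Φpos hyp
  have hll : 0 < l 0 * l 0 + l 1 * l 1 + l 2 * l 2 := by
    by_contra hn
    apply hl
    ext i
    fin_cases i <;> simp <;> nlinarith [mul_self_nonneg (l 0), mul_self_nonneg (l 1),
      mul_self_nonneg (l 2)]
  unfold InPlane at hx hy
  rw [triple_apply] at h
  have c0 : x 1 * y 2 - x 2 * y 1 = 0 := by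
    refine (mul_eq_zero.1 (?_ : (l 0 * l 0 + l 1 * l 1 + l 2 * l 2) * _ = 0)).resolve_left hll.ne'
    linear_combination l 0 * h + (l 1 * y 2 - l 2 * y 1) * hx - (l 1 * x 2 - l 2 * x 1) * hy
  have c1 : x 2 * y 0 - x 0 * y 2 = 0 := by
    refine (mul_eq_zero.1 (?_ : (l 0 * l 0 + l 1 * l 1 + l 2 * l 2) * _ = 0)).resolve_left hll.ne'
    linear_combination l 1 * h + (l 2 * y 0 - l 0 * y 2) * hx - (l 2 * x 0 - l 0 * x 2) * hy
  have c2 : x 0 * y 1 - x 1 * y 0 = 0 := by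
    refine (mul_eq_zero.1 (?_ : (l 0 * l 0 + l 1 * l 1 + l 2 * l 2) * _ = 0)).resolve_left hll.ne'
    linear_combination l 2 * h + (l 0 * y 1 - l 1 * y 0) * hx - (l 0 * x 1 - l 1 * x 0) * hy
  refine ⟨(y 0 + y 1 + y 2) / (x 0 + x 1 + x 2), div_nonneg hsy.le hsx.le, ?_⟩
  ext i
  simp only [Pi.smul_apply, smul_eq_mul]
  rw [div_mul_eq_mul_div, eq_div_iff hsx.ne']
  fin_cases i <;> simp
  · linear_combination c1 - c2
  · linear_combination c2 - c0
  · linear_combination c0 - c1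

lemma between {l x y z : V} (hl : l ≠ 0) (hx : InPlane l x) (hy : InPlane l y) (hz : InPlane l z)
    (hxp : x ∈ Φpos) (hyp : y ∈ Φpos) (hzp : z ∈ Φpos) (hxy : 0 < triple l x y)
    (hyz : 0 < triple l y z) : ∃ s t : ℝ, 0 ≤ s ∧ 0 ≤ t ∧ y = s • x + t • z := by
  have hrel := triple_relation hl hx hy hz
  have hsx := sum_pos_of_mem_Φpos hxp
  have hsy := sum_pos_of_mem_Φpos hyp
  have hsz := sum_pos_of_mem_Φpos hzp
  have hc : ∀ i, triple l y z * x i + triple l z x * y i + triple l x y * z i = 0 := fun i => by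
    simpa using congrFun hrel i
  have hsum : triple l y z * (x 0 + x 1 + x 2) + triple l z x * (y 0 + y 1 + y 2) +
      triple l x y * (z 0 + z 1 + z 2) = 0 := by
    linear_combination hc 0 + hc 1 + hc 2
  have hneg : triple l z x < 0 := by
    by_contra hn
    nlinarith [mul_pos hyz hsx, mul_pos hxy hsz, mul_nonneg (not_lt.1 hn) hsy.le]
  refine ⟨triple l y z / -triple l z x, triple l x y / -triple l z x,
    div_nonneg hyz.le (neg_pos.2 hneg).le, div_nonneg hxy.le (neg_pos.2 hneg).le, ?_⟩
  ext i
  simp only [Pi.add_apply, Pi.smul_apply, smul_eq_mul]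
  have hne : -triple l z x ≠ 0 := (neg_pos.2 hneg).ne'
  rw [div_mul_eq_mul_div, div_mul_eq_mul_div, ← add_div, eq_div_iff hne]
  linear_combination -hc i

/-- Inside a plane, the two halves of a biclosed set have disjoint cones. -/
lemma planar_separation {l : V} (hl : l ≠ 0) {R : Set V} (hR : IsBiclosed R) {v : V}
    (hv : v ∈ nnspan {x ∈ R | InPlane l x}) (hv' : v ∈ nnspan {x ∈ Φpos \ R | InPlane l x}) :
    v = 0 := by
  obtain ⟨hsub, hc, hc'⟩ := hR
  have hne : ∀ r ∈ R, InPlane l r → ∀ c ∈ Φpos \ R, InPlane l c → triple l r c ≠ 0 := by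
    intro r hr hrl c hcC hcl h
    obtain ⟨s, hs, e⟩ := exists_smul_of_triple_eq_zero hl hrl hcl (hsub hr) hcC.1 h
    exact hcC.2 (hc.mem hr hr hcC.1 hs le_rfl (by rw [e]; simp))
  have hdich : (∀ r ∈ R, InPlane l r → ∀ c ∈ Φpos \ R, InPlane l c → 0 < triple l r c) ∨
      (∀ r ∈ R, InPlane l r → ∀ c ∈ Φpos \ R, InPlane l c → 0 < -triple l r c) := by
    by_contra hcon
    push Not at hcon
    obtain ⟨⟨r', hr', hrl', c', hcC', hcl', h'⟩, ⟨r, hr, hrl, c, hcC, hcl, h⟩⟩ := hcon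
    have h1 : 0 < triple l r c := lt_of_le_of_ne (by linarith) (hne r hr hrl c hcC hcl).symm
    have h2 : 0 < triple l c' r' := by
      rw [triple_swap l r' c']
      have := lt_of_le_of_ne h' (hne r' hr' hrl' c' hcC' hcl')
      linarith
    rcases lt_or_gt_of_ne (hne r' hr' hrl' c hcC hcl) with h3 | h3
    · obtain ⟨s, t, hs, ht, e⟩ := between hl hrl hcl hrl' (hsub hr) hcC.1 (hsub hr') h1
        (by rw [triple_swap l r' c]; linarith)
      exact hcC.2 (hc.mem hr hr' hcC.1 hs ht e)
    · obtain ⟨s, t, hs, ht, e⟩ := between hl hcl' hrl' hcl hcC'.1 (hsub hr') hcC.1 h2 h3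
      exact (hc'.mem hcC' hcC (hsub hr') hs ht e).2 hr'
  by_contra hv0
  have hself : triple l v v = 0 := by simp only [triple_apply]; ring
  rcases hdich with h | h
  · have h1 : ∀ c ∈ {x ∈ Φpos \ R | InPlane l x}, 0 < triple l v c := fun c hc =>
      (eq_zero_or_pos_of_mem_nnspan ((triple l).flip c)
        (fun r hr => h r hr.1 hr.2 c hc.1 hc.2) hv).resolve_left hv0
    have := (eq_zero_or_pos_of_mem_nnspan (triple l v) h1 hv').resolve_left hv0
    linarith
  · have h1 : ∀ c ∈ {x ∈ Φpos \ R | InPlane l x}, 0 < (-triple l v) c := fun c hc =>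
      (eq_zero_or_pos_of_mem_nnspan (-(triple l).flip c)
        (fun r hr => h r hr.1 hr.2 c hc.1 hc.2) hv).resolve_left hv0
    have := (eq_zero_or_pos_of_mem_nnspan (-triple l v) h1 hv').resolve_left hv0
    simp only [LinearMap.neg_apply] at this
    linarith

lemma IsSignSystem.neg_set {P : Set V} (hP : IsSignSystem P) : IsSignSystem {x | -x ∈ P} where
  subset x hx := by simpa using neg_mem_Φ (hP.subset hx)
  closed a ha b hb x hx s t hs ht e :=
    hP.closed _ ha _ hb _ (neg_mem_Φ hx) s t hs ht (by rw [e]; module)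
  neg x hx := hP.neg _ (neg_mem_Φ hx)

theorem exists_functional {P : Set V} (hP : IsSignSystem P) :
    ∃ l : V, l ≠ 0 ∧ ∀ x ∈ P, 0 ≤ l 0 * x 0 + l 1 * x 1 + l 2 * x 2 := by
  by_cases hN : Nonpure fun p q => prodV p q ∈ P
  · obtain ⟨w, hw, h⟩ := exists_form_nonneg hP.isSign hN
    refine ⟨formVec (w 0) (w 1) (w 2), formVec_ne_zero fun h0 => hw ?_, fun x hx => ?_⟩
    · ext i
      fin_cases i
      exacts [h0.1, h0.2.1, h0.2.2]
    · obtain ⟨p, q, hd, rfl⟩ := exists_prodV_of_mem_Φ (hP.subset hx)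
      rw [formVec_pairing]
      exact h p q hd hx
  · simp only [Nonpure, not_forall] at hN
    obtain ⟨p, q, hd, h⟩ := hN
    rw [not_and_or, not_not, not_not] at h
    rcases h with ⟨h1, h2, h3⟩ | ⟨h1, h2, h3⟩
    · exact exists_functional_of_triangle hP hd h1 h2 h3
    · have hmem : ∀ p q, det p q = 1 → prodV p q ∉ P → -prodV p q ∈ P := fun p q hd h =>
        (hP.neg _ (prodV_mem_Φ (by rw [hd]; rfl))).2 h
      obtain ⟨l, hl, h⟩ := exists_functional_of_triangle hP.neg_set hd
        (hmem _ _ (by rw [← hd]; simp only [det, Prod.fst_add, Prod.snd_add]; ring) h1)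
        (hmem _ _ (by rw [← hd]; simp only [det, Prod.fst_add, Prod.snd_add]; ring) h2)
        (hmem _ _ (by rw [← hd]; simp only [det, Prod.fst_neg, Prod.snd_neg]; ring) h3)
      refine ⟨-l, neg_ne_zero.2 hl, fun x hx => ?_⟩
      have := h (-x) (by simpa using hx)
      simpa using this

/-- The linear functional with given coefficients. -/
def pairing (l : V) : V →ₗ[ℝ] ℝ where
  toFun x := l 0 * x 0 + l 1 * x 1 + l 2 * x 2
  map_add' := by intros; simp only [Pi.add_apply]; ring
  map_smul' := by intros; simp only [Pi.smul_apply, smul_eq_mul, RingHom.id_apply]; ring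

/-- Every biclosed subset `R` of `Φ⁺` is weakly separable:
`Span_{≥0}(R) ∩ Span_{≥0}(Φ⁺ \ R) = {0}`. -/
theorem biclosed_weakly_separable (R : Set V) (hR : IsBiclosed R) :
    nnspan R ∩ nnspan (Φpos \ R) = {0} := by
  obtain ⟨l, hl, hpos⟩ := exists_functional hR.isSignSystem
  have hposR : ∀ x ∈ R, 0 ≤ pairing l x := fun x hx => hpos x (Or.inl hx)
  have hposC : ∀ x ∈ Φpos \ R, 0 ≤ (-pairing l) x := by
    intro x hx
    have := hpos (-x) (Or.inr (by rwa [neg_neg]))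
    simp only [Pi.neg_apply] at this
    simp only [LinearMap.neg_apply, pairing, LinearMap.coe_mk, AddHom.coe_mk]
    linarith
  refine Set.Subset.antisymm ?_ ?_
  · rintro v ⟨hv, hv'⟩
    obtain ⟨h1, h1'⟩ := mem_nnspan_ker _ hposR hv
    obtain ⟨h2, h2'⟩ := mem_nnspan_ker _ hposC hv'
    have h0 : pairing l v = 0 := by
      rw [LinearMap.neg_apply] at h2
      linarith
    refine planar_separation hl hR (h1' h0) ?_
    have := h2' (by rw [LinearMap.neg_apply, h0, neg_zero])
    simp only [LinearMap.neg_apply, neg_eq_zero] at this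
    exact this
  · rintro _ rfl
    exact ⟨Submodule.zero_mem _, Submodule.zero_mem _⟩
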